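/- Let f : T₀ → T be a morphism between two metric G-trees belonging to the same deformation space. Then the set of intermediate trees T_t, for t ∈ [0,∞], arising from Skora's deformation of f is contained in a finite union of cones. -/

import Mathlib

set_option autoImplicit false
set_option maxHeartbeats 1000000
open scoped Classical

universe u

section Trees

variable (G : Type u) [Group G]

/-- A (minimal, simplicial) `G`-tree: a simplicial tree together with an action of `G` by
simplicial automorphisms, without inversions, admitting no proper invariant subtree. -/
structure GTree : Type (u + 1) where
  V : Type u
  nonempty : Nonempty V
  graph : SimpleGraph V
  isTree : graph.IsTree
  act : G →* Equiv.Perm V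
  adj_act : ∀ (g : G) (u v : V), graph.Adj u v → graph.Adj (act g u) (act g v)
  noInversion : ∀ (g : G) (u v : V), graph.Adj u v → ¬(act g u = v ∧ act g v = u)
  minimal : ∀ S : Set V, S.Nonempty → (∀ (g : G), ∀ v ∈ S, act g v ∈ S) →
      (∀ u ∈ S, ∀ v ∈ S, ∀ p : graph.Walk u v, p.IsPath → ∀ w ∈ p.support, w ∈ S) →
      S = Set.univ

variable {G}

namespace GTree

variable (T : GTree G)

/-- The stabilizer of a vertex. -/
def stab (v : T.V) : Subgroup G where
  carrier := {g : G | T.act g v = v}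
  one_mem' := by simp
  mul_mem' := by
    intro a b ha hb
    simp only [Set.mem_setOf_eq, map_mul, Equiv.Perm.mul_apply] at *
    rw [hb, ha]
  inv_mem' := by
    intro a ha
    simp only [Set.mem_setOf_eq] at *
    have h : T.act a⁻¹ (T.act a v) = v := by
      rw [← Equiv.Perm.mul_apply, ← map_mul, inv_mul_cancel, map_one, Equiv.Perm.one_apply]
    rwa [ha] at h

/-- The (pointwise) stabilizer of an edge `uv`; since the action has no inversions this is
the full stabilizer of the edge. -/
def edgeStab (u v : T.V) : Subgroup G := T.stab u ⊓ T.stab v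

/-- A subgroup of `G` is elliptic if it fixes a vertex. -/
def Elliptic (H : Subgroup G) : Prop := ∃ v : T.V, ∀ h ∈ H, T.act h v = v

/-- An element of `G` is elliptic if it fixes a vertex. -/
def EllipticElt (g : G) : Prop := ∃ v : T.V, T.act g v = v

/-- An element of `G` is hyperbolic if it fixes no vertex. -/
def Hyperbolic (g : G) : Prop := ∀ v : T.V, T.act g v ≠ v

/-- A `G`-tree is reduced if whenever the stabilizer of an edge `uv` equals the stabilizer
of `u` (i.e. `G_u ≤ G_v`), the two endpoints are in the same orbit. -/
def Reduced : Prop :=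
  ∀ u v : T.V, T.graph.Adj u v → T.stab u ≤ T.stab v → ∃ g : G, T.act g u = v

/-- `T` is a single point. -/
protected def Trivial : Prop := ∀ u v : T.V, u = v

/-- `T` is a (simplicial) line. -/
def IsLine : Prop := ∀ v : T.V, ∃ a b : T.V, a ≠ b ∧ {w : T.V | T.graph.Adj v w} = {a, b}

/-- `G` fixes an end of `T`: there is an equivariant choice, for each vertex, of the next
vertex in the direction of the fixed end. -/
def FixesEnd : Prop :=
  ∃ next : T.V → T.V, (∀ v, T.graph.Adj v (next v)) ∧
    (∀ (g : G) (v : T.V), next (T.act g v) = T.act g (next v)) ∧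
    (∀ v, next (next v) ≠ v)

/-- Linear abelian type: `T` is a line on which `G` acts by translations (every element acts
either trivially or freely). -/
def LinearAbelian : Prop :=
  T.IsLine ∧ ∀ g : G, (∀ v : T.V, T.act g v = v) ∨ (∀ v : T.V, T.act g v ≠ v)

/-- Dihedral type: `T` is a line and some element acts as a reflection. -/
def Dihedral : Prop :=
  T.IsLine ∧ ∃ g : G, (∃ v : T.V, T.act g v = v) ∧ (∃ w : T.V, T.act g w ≠ w)

/-- Genuine abelian type: `G` fixes an end and `T` is not a line. -/
def GenuineAbelian : Prop := T.FixesEnd ∧ ¬T.IsLine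

/-- Irreducibility, via the characterization by hyperbolicity of a commutator. -/
def Irred : Prop :=
  ∃ g h : G, T.Hyperbolic g ∧ T.Hyperbolic h ∧ T.Hyperbolic (g * h * g⁻¹ * h⁻¹)

/-- The image of a dart (oriented edge) under the action of `g`. -/
def dartAct (g : G) (d : T.graph.Dart) : T.graph.Dart :=
  ⟨(T.act g d.toProd.1, T.act g d.toProd.2), T.adj_act g d.toProd.1 d.toProd.2 d.adj⟩

/-- Three oriented edges are aligned (in this order) if some geodesic crosses them
successively, with the correct orientations. -/
def Aligned (d₁ d₂ d₃ : T.graph.Dart) : Prop :=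
  ∃ (u v : T.V) (p : T.graph.Walk u v), p.IsPath ∧ [d₁, d₂, d₃].Sublist p.darts

end GTree

/-- Two `G`-trees lie in the same deformation space iff they have the same elliptic
subgroups. -/
def SameDef (T T' : GTree G) : Prop := ∀ H : Subgroup G, T.Elliptic H ↔ T'.Elliptic H

/-- An equivariant isomorphism of simplicial `G`-trees. -/
def SimpIso (T T' : GTree G) : Prop :=
  ∃ e : T.V ≃ T'.V, (∀ (g : G) (v : T.V), e (T.act g v) = T'.act g (e v)) ∧
    ∀ u v : T.V, T.graph.Adj u v ↔ T'.graph.Adj (e u) (e v)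

end Trees
section Collapses

variable {G : Type u} [Group G]

/-- Two ordered pairs of adjacent vertices span edges in the same `G`-orbit
(as non-oriented edges). -/
def InEdgeOrbit (T : GTree G) (a b c d : T.V) : Prop :=
  ∃ g : G, (T.act g a = c ∧ T.act g b = d) ∨ (T.act g a = d ∧ T.act g b = c)

/-- `c` exhibits `T'` as a (possibly non-elementary) collapse of `T`: it is equivariant,
surjective, sends non-collapsed edges to edges, is onto the edges of `T'`, and its point
preimages are subtrees. -/
def IsCollapseMap (T T' : GTree G) (c : T.V → T'.V) : Prop :=
  (∀ (g : G) (v : T.V), c (T.act g v) = T'.act g (c v)) ∧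
  Function.Surjective c ∧
  (∀ u v : T.V, T.graph.Adj u v → c u ≠ c v → T'.graph.Adj (c u) (c v)) ∧
  (∀ u' v' : T'.V, T'.graph.Adj u' v' → ∃ u v : T.V, T.graph.Adj u v ∧ c u = u' ∧ c v = v') ∧
  (∀ u v : T.V, c u = c v → ∀ p : T.graph.Walk u v, p.IsPath → ∀ w ∈ p.support, c w = c u)

/-- `T'` is obtained from `T` by a (possibly non-elementary) collapse. -/
def CollapseOf (T' T : GTree G) : Prop := ∃ c : T.V → T'.V, IsCollapseMap T T' c

/-- `T'` is obtained from `T` by collapsing (exactly) all the edges in the orbit of a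
single edge. -/
def IsOrbitCollapse (T' T : GTree G) : Prop :=
  ∃ (c : T.V → T'.V) (u₀ v₀ : T.V), T.graph.Adj u₀ v₀ ∧ IsCollapseMap T T' c ∧
    ∀ u v : T.V, T.graph.Adj u v → (c u = c v ↔ InEdgeOrbit T u v u₀ v₀)

/-- An elementary collapse: collapsing the orbit of a collapsible edge, i.e. an orbit
collapse staying in the same deformation space. -/
def ElemCollapse (T T' : GTree G) : Prop := IsOrbitCollapse T' T ∧ SameDef T T'

/-- An elementary move: an elementary collapse or an elementary expansion. -/
def ElemMove (T T' : GTree G) : Prop := ElemCollapse T T' ∨ ElemCollapse T' T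

/-- An elementary deformation: a finite sequence of elementary collapses and expansions. -/
def ElemDeformation (T T' : GTree G) : Prop := Relation.ReflTransGen ElemMove T T'

/-- A slide move: an edge `f = vx` with `G_f ≤ G_e` slides across `e = vw` (and
equivariantly so does its orbit), becoming an edge `f' = wx`. -/
def SlideMove (T T' : GTree G) : Prop :=
  ∃ (e : T.V ≃ T'.V) (v w x : T.V),
    T.graph.Adj v w ∧ T.graph.Adj v x ∧ w ≠ x ∧
    T.edgeStab v x ≤ T.edgeStab v w ∧
    ¬InEdgeOrbit T v w v x ∧
    (∀ (g : G) (u : T.V), e (T.act g u) = T'.act g (e u)) ∧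
    (∀ a b : T.V, T'.graph.Adj (e a) (e b) ↔
      ((T.graph.Adj a b ∧ ¬InEdgeOrbit T a b v x) ∨ InEdgeOrbit T a b w x))

end Collapses

section MetricTrees

variable (G : Type u) [Group G]

/-- A metric `G`-tree: a simplicial `G`-tree together with an equivariant assignment of
positive lengths to the edges. -/
structure MGTree extends GTree G : Type (u + 1) where
  len : V → V → ℝ
  len_symm : ∀ u v : V, len u v = len v u
  len_pos : ∀ u v : V, graph.Adj u v → 0 < len u v
  len_equivariant : ∀ (g : G) (u v : V), len (act g u) (act g v) = len u v

variable {G}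

namespace MGTree

variable (T : MGTree G)

/-- The length of a walk. -/
noncomputable def walkLen {u v : T.V} (p : T.graph.Walk u v) : ℝ :=
  (p.darts.map fun d => T.len d.toProd.1 d.toProd.2).sum

/-- The distance between two vertices: the length of the unique reduced path joining them. -/
noncomputable def dist (u v : T.V) : ℝ :=
  sInf {x : ℝ | ∃ p : T.graph.Walk u v, p.IsPath ∧ x = T.walkLen p}

/-- The translation length of `g`. -/
noncomputable def ell (g : G) : ℝ :=
  sInf {x : ℝ | ∃ v : T.V, x = T.dist v (T.act g v)}

/-- The axis (or characteristic set) of `g`: the set of points moved exactly `ℓ(g)`. -/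
def Axis (g : G) : Set T.V := {v : T.V | T.dist v (T.act g v) = T.ell g}

/-- `T` is abelian: its length function is the absolute value of a homomorphism to `ℝ`
with cyclic image. -/
def IsAbelian : Prop :=
  ∃ φ : G → ℝ, (∀ g h : G, φ (g * h) = φ g + φ h) ∧
    (∃ a : ℝ, ∀ g : G, ∃ n : ℤ, φ g = (n : ℝ) * a) ∧
    ∀ g : G, T.ell g = |φ g|

/-- Irreducibility for metric trees: two hyperbolic elements with disjoint axes. -/
def Irr : Prop :=
  ∃ g h : G, T.toGTree.Hyperbolic g ∧ T.toGTree.Hyperbolic h ∧ T.Axis g ∩ T.Axis h = ∅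

end MGTree

/-- An equivariant simplicial isomorphism multiplying all edge lengths by `c`. -/
def EquivHomothety (c : ℝ) (T T' : MGTree G) : Prop :=
  ∃ e : T.V ≃ T'.V, (∀ (g : G) (v : T.V), e (T.act g v) = T'.act g (e v)) ∧
    (∀ u v : T.V, T.graph.Adj u v ↔ T'.graph.Adj (e u) (e v)) ∧
    ∀ u v : T.V, T.graph.Adj u v → T'.len (e u) (e v) = c * T.len u v

/-- An equivariant isometry of metric `G`-trees. -/
def EquivIsometric (T T' : MGTree G) : Prop := EquivHomothety 1 T T'

/-- The action of an automorphism of `G` on metric `G`-trees, by precomposition. -/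
def MGTree.precomp (φ : MulAut G) (T : MGTree G) : MGTree G where
  V := T.V
  nonempty := T.nonempty
  graph := T.graph
  isTree := T.isTree
  act := T.act.comp φ.toMonoidHom
  adj_act := fun g u v h => T.adj_act (φ g) u v h
  noInversion := fun g u v h => T.noInversion (φ g) u v h
  minimal := fun S h1 h2 h3 => T.minimal S h1
    (fun g v hv => by simpa using h2 (φ.symm g) v hv) h3
  len := T.len
  len_symm := T.len_symm
  len_pos := T.len_pos
  len_equivariant := fun g u v => T.len_equivariant (φ g) u v

end MetricTrees
section Topologies

variable (G : Type u) [Group G]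

/-- Basic Gromov–Hausdorff neighbourhood of the metric `G`-tree `T` determined by finite
sets `X ⊆ T`, `A ⊆ G` and `ε > 0`: the trees admitting an `ε`-approximate equivariant
lift of `X`. -/
def gromovBasic (T : MGTree G) (X : Finset T.V) (A : Finset G) (ε : ℝ) : Set (MGTree G) :=
  {T' : MGTree G | ∃ f : T.V → T'.V, ∀ x ∈ X, ∀ y ∈ X, ∀ g ∈ A,
    |T.dist x (T.act g y) - T'.dist (f x) (T'.act g (f y))| < ε}

/-- The equivariant Gromov–Hausdorff topology on the space of metric `G`-trees. -/
noncomputable def gromovTop : TopologicalSpace (MGTree G) where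
  IsOpen U := ∀ T ∈ U, ∃ (X : Finset T.V) (A : Finset G) (ε : ℝ), 0 < ε ∧
    gromovBasic G T X A ε ⊆ U
  isOpen_univ := fun T _ => ⟨∅, ∅, 1, one_pos, Set.subset_univ _⟩
  isOpen_inter := by
    intro U V hU hV T hT
    obtain ⟨X₁, A₁, ε₁, hε₁, h₁⟩ := hU T hT.1
    obtain ⟨X₂, A₂, ε₂, hε₂, h₂⟩ := hV T hT.2
    refine ⟨X₁ ∪ X₂, A₁ ∪ A₂, min ε₁ ε₂, lt_min hε₁ hε₂, ?_⟩
    intro T' hT'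
    obtain ⟨f, hf⟩ := hT'
    constructor
    · exact h₁ ⟨f, fun x hx y hy g hg =>
        lt_of_lt_of_le (hf x (Finset.mem_union_left _ hx) y (Finset.mem_union_left _ hy) g
          (Finset.mem_union_left _ hg)) (min_le_left _ _)⟩
    · exact h₂ ⟨f, fun x hx y hy g hg =>
        lt_of_lt_of_le (hf x (Finset.mem_union_right _ hx) y (Finset.mem_union_right _ hy) g
          (Finset.mem_union_right _ hg)) (min_le_right _ _)⟩
  isOpen_sUnion := by
    intro s hs T hT
    obtain ⟨U, hUs, hTU⟩ := hT
    obtain ⟨X, A, ε, hε, h⟩ := hs U hUs T hTU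
    exact ⟨X, A, ε, hε, h.trans (Set.subset_sUnion_of_mem hUs)⟩

variable {G}

/-- The closed cone of the (restricted) deformation space `D` spanned by `T`: the trees
of `D` obtained from trees having the same underlying simplicial tree as `T` by
(elementary) collapses. -/
def closedCone (D : Set (MGTree G)) (T : MGTree G) : Set (MGTree G) :=
  {T' : MGTree G | T' ∈ D ∧ CollapseOf T'.toGTree T.toGTree}

/-- The open cone containing `T`: the trees with the same underlying simplicial tree. -/
def openCone (D : Set (MGTree G)) (T : MGTree G) : Set (MGTree G) :=
  {T' : MGTree G | T' ∈ D ∧ SimpIso T'.toGTree T.toGTree}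

variable (G)

/-- The weak topology on a deformation space `D`: a set is closed if and only if its
intersection with every closed cone of `D` is closed (each closed cone carrying the
Gromov topology). -/
noncomputable def weakTop (D : Set (MGTree G)) : TopologicalSpace ↥D :=
  ⨆ (T : MGTree G) (_ : T ∈ D), TopologicalSpace.coinduced
    (fun x : {S : MGTree G // S ∈ closedCone D T} => (⟨x.1, x.2.1⟩ : ↥D))
    (TopologicalSpace.induced (fun x : {S : MGTree G // S ∈ closedCone D T} => x.1)
      (gromovTop G))

variable {G}

/-- The projectivizing relation on a deformation space: agreement up to rescaling, i.e.
equivariant homothety. -/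
def projRel (D : Set (MGTree G)) (a b : ↥D) : Prop :=
  ∃ c : ℝ, 0 < c ∧ EquivHomothety c a.1 b.1

/-- The relation of equivariant isometry on a deformation space. -/
def isomRel (D : Set (MGTree G)) (a b : ↥D) : Prop := EquivIsometric a.1 b.1

end Topologies

section Morphisms

variable {G : Type u} [Group G]

/-- A morphism of simplicial `G`-trees: an equivariant map sending each edge onto a
non-degenerate edge path (obtained by subdividing the edge into finitely many subsegments,
each mapped bijectively onto an edge). -/
structure GMorphism (T T' : GTree G) where
  f : T.V → T'.V
  equivariant : ∀ (g : G) (v : T.V), f (T.act g v) = T'.act g (f v)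
  edgeWalk : ∀ u v : T.V, T.graph.Adj u v → T'.graph.Walk (f u) (f v)
  edgeWalk_ne_nil : ∀ (u v : T.V) (h : T.graph.Adj u v), ¬(edgeWalk u v h).Nil
  edgeWalk_symm : ∀ (u v : T.V) (h : T.graph.Adj u v),
    (edgeWalk v u h.symm).support = (edgeWalk u v h).support.reverse
  edgeWalk_equivariant : ∀ (g : G) (u v : T.V) (h : T.graph.Adj u v),
    (edgeWalk (T.act g u) (T.act g v) (T.adj_act g u v h)).support =
      (edgeWalk u v h).support.map (fun x => T'.act g x)

/-- `H` is bi-elliptic in `T`: it fixes two distinct points. -/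
def BiElliptic (T : GTree G) (H : Subgroup G) : Prop :=
  ∃ u v : T.V, u ≠ v ∧ ∀ h ∈ H, T.act h u = u ∧ T.act h v = v

/-- `H` is a generalized edge group of `T`: it is squeezed between two edge stabilizers. -/
def GenEdgeGroup (T : GTree G) (H : Subgroup G) : Prop :=
  ∃ u v u' v' : T.V, T.graph.Adj u v ∧ T.graph.Adj u' v' ∧
    T.edgeStab u v ≤ H ∧ H ≤ T.edgeStab u' v'

/-- `H` belongs to `𝒜_min` (relative to the deformation space of `T₀`): it fixes an edge
in every tree of the deformation space. -/
def Amin (T₀ : GTree G) (H : Subgroup G) : Prop :=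
  ∀ T : GTree G, SameDef T₀ T → ∃ u v : T.V, T.graph.Adj u v ∧ H ≤ T.edgeStab u v

/-- A maximal elliptic subgroup (of the deformation space of `T₀`). -/
def MaxElliptic (T₀ : GTree G) (H : Subgroup G) : Prop :=
  T₀.Elliptic H ∧ ∀ K : Subgroup G, T₀.Elliptic K → H ≤ K → K = H

end Morphisms

section OutG

variable (G : Type u) [Group G]

instance innRange_normal : ((MulAut.conj : G →* MulAut G).range).Normal := by
  constructor
  intro a ha φ
  obtain ⟨g, rfl⟩ := ha
  refine ⟨φ g, ?_⟩
  ext x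
  simp only [MulAut.mul_apply, MulAut.conj_apply, map_mul, map_inv]
  simp [MulAut.inv_def]

/-- The outer automorphism group of `G`. -/
def OutG := MulAut G ⧸ (MulAut.conj : G →* MulAut G).range

noncomputable instance : Group (OutG G) := QuotientGroup.Quotient.group _

/-- The class of an automorphism in `Out(G)`. -/
def toOutG (φ : MulAut G) : OutG G := QuotientGroup.mk φ

end OutG
section RealTrees

variable (G : Type u) [Group G]

/-- A non-trivial minimal `ℝ`-tree with an isometric action of `G`: a geodesic metric
space in which any two points are joined by a unique arc. -/
structure RGTree : Type (u + 1) where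
  X : Type u
  [ms : MetricSpace X]
  nontrivial : Nontrivial X
  geodesic : ∀ x y : X, ∃ f : ℝ → X, f 0 = x ∧ f (dist x y) = y ∧
    ∀ s ∈ Set.Icc (0 : ℝ) (dist x y), ∀ t ∈ Set.Icc (0 : ℝ) (dist x y),
      dist (f s) (f t) = |s - t|
  unique_arc : ∀ (x y : X) (γ : Set.Icc (0 : ℝ) 1 → X), Continuous γ →
    Function.Injective γ → γ ⟨0, by constructor <;> norm_num⟩ = x →
    γ ⟨1, by constructor <;> norm_num⟩ = y →
    ∀ z ∈ Set.range γ, dist x z + dist z y = dist x y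
  act : G →* Equiv.Perm X
  isom : ∀ g : G, Isometry (act g)
  minimal : ∀ S : Set X, S.Nonempty → (∀ (g : G), ∀ x ∈ S, act g x ∈ S) →
    (∀ x ∈ S, ∀ y ∈ S, ∀ z : X, dist x z + dist z y = dist x y → z ∈ S) →
    S = Set.univ

attribute [instance] RGTree.ms

variable {G}

namespace RGTree

variable (R : RGTree G)

/-- `z` lies between `x` and `y` (i.e. on the arc from `x` to `y`). -/
def Btw (x z y : R.X) : Prop := dist x z + dist z y = dist x y

/-- A subgroup is elliptic if it fixes a point. -/
def Elliptic (H : Subgroup G) : Prop := ∃ x : R.X, ∀ h ∈ H, R.act h x = x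

/-- A hyperbolic element fixes no point. -/
def Hyperbolic (g : G) : Prop := ∀ x : R.X, R.act g x ≠ x

/-- The translation length of `g`. -/
noncomputable def ell (g : G) : ℝ :=
  sInf {r : ℝ | ∃ x : R.X, r = dist x (R.act g x)}

/-- The characteristic set of `g`: its axis if `g` is hyperbolic, its fixed point set
if `g` is elliptic. -/
def Axis (g : G) : Set R.X := {x : R.X | dist x (R.act g x) = R.ell g}

/-- The fixed point set of `g`. -/
def Fix (g : G) : Set R.X := {x : R.X | R.act g x = x}

/-- The fixed point set of a subgroup. -/
def FixSub (H : Subgroup G) : Set R.X := {x : R.X | ∀ h ∈ H, R.act h x = x}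

/-- Irreducibility: two hyperbolic elements with disjoint characteristic sets. -/
def Irr : Prop :=
  ∃ g h : G, R.Hyperbolic g ∧ R.Hyperbolic h ∧ R.Axis g ∩ R.Axis h = ∅

/-- The distance between the characteristic sets of `g` and `h`. -/
noncomputable def axesDist (g h : G) : ℝ :=
  sInf {r : ℝ | ∃ x ∈ R.Axis g, ∃ y ∈ R.Axis h, r = dist x y}

end RGTree

/-- `f` realizes the metric simplicial `G`-tree `T` inside the `ℝ`-tree `R`. -/
def IsRealizationMap (R : RGTree G) (T : MGTree G) (f : T.V → R.X) : Prop :=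
  (∀ (g : G) (v : T.V), f (T.act g v) = R.act g (f v)) ∧
  (∀ u v : T.V, dist (f u) (f v) = T.dist u v) ∧
  ∀ x : R.X, ∃ u v : T.V, T.graph.Adj u v ∧ R.Btw (f u) x (f v)

/-- The `ℝ`-tree `R` is (equivariantly isometric to) the geometric realization of the
metric simplicial `G`-tree `T`. -/
def RealizationOf (R : RGTree G) (T : MGTree G) : Prop := ∃ f : T.V → R.X, IsRealizationMap R T f

variable (G)

/-- The equivariant Gromov–Hausdorff topology on the space of `ℝ`-trees. -/
noncomputable def gromovTopR : TopologicalSpace (RGTree G) where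
  IsOpen U := ∀ R ∈ U, ∃ (X : Finset R.X) (A : Finset G) (ε : ℝ), 0 < ε ∧
    {R' : RGTree G | ∃ f : R.X → R'.X, ∀ x ∈ X, ∀ y ∈ X, ∀ g ∈ A,
      |dist x (R.act g y) - dist (f x) (R'.act g (f y))| < ε} ⊆ U
  isOpen_univ := fun R _ => ⟨∅, ∅, 1, one_pos, Set.subset_univ _⟩
  isOpen_inter := by
    intro U V hU hV R hR
    obtain ⟨X₁, A₁, ε₁, hε₁, h₁⟩ := hU R hR.1
    obtain ⟨X₂, A₂, ε₂, hε₂, h₂⟩ := hV R hR.2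
    refine ⟨X₁ ∪ X₂, A₁ ∪ A₂, min ε₁ ε₂, lt_min hε₁ hε₂, ?_⟩
    rintro R' ⟨f, hf⟩
    constructor
    · exact h₁ ⟨f, fun x hx y hy g hg =>
        lt_of_lt_of_le (hf x (Finset.mem_union_left _ hx) y (Finset.mem_union_left _ hy) g
          (Finset.mem_union_left _ hg)) (min_le_left _ _)⟩
    · exact h₂ ⟨f, fun x hx y hy g hg =>
        lt_of_lt_of_le (hf x (Finset.mem_union_right _ hx) y (Finset.mem_union_right _ hy) g
          (Finset.mem_union_right _ hg)) (min_le_right _ _)⟩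
  isOpen_sUnion := by
    intro s hs R hR
    obtain ⟨U, hUs, hRU⟩ := hR
    obtain ⟨X, A, ε, hε, h⟩ := hs U hUs R hRU
    exact ⟨X, A, ε, hε, h.trans (Set.subset_sUnion_of_mem hUs)⟩

/-- The axes topology: the coarsest topology making all translation length functions
continuous. -/
noncomputable def axesTopR : TopologicalSpace (RGTree G) :=
  TopologicalSpace.induced (fun (R : RGTree G) (g : G) => R.ell g) Pi.topologicalSpace

variable {G}

/-- A morphism of `ℝ`-trees: an equivariant map such that every segment is a finite union
of subsegments on each of which the map is isometric. -/
structure RMorphism (R S : RGTree G) where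
  f : R.X → S.X
  equivariant : ∀ (g : G) (x : R.X), f (R.act g x) = S.act g (f x)
  piecewise : ∀ x y : R.X, ∃ (n : ℕ) (c : Fin (n + 1) → R.X),
    c 0 = x ∧ c (Fin.last n) = y ∧ (∀ i : Fin (n + 1), R.Btw x (c i) y) ∧
    ∀ i : Fin n, ∀ p q : R.X, R.Btw (c i.castSucc) p (c i.succ) →
      R.Btw (c i.castSucc) q (c i.succ) → dist (f p) (f q) = dist p q

/-- `M` is the intermediate tree at time `t` of Skora's deformation of the morphism `φ`:
the quotient of the source in which `x` and `y` are identified exactly when `φ` maps the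
segment `[x,y]` into the ball of radius `t` around `φ(x) = φ(y)`. -/
def IsSkoraIntermediate {R S : RGTree G} (φ : RMorphism R S) (t : ℝ) (M : RGTree G) : Prop :=
  ∃ (p : R.X → M.X) (q : M.X → S.X), Function.Surjective p ∧
    (∀ (g : G) (x : R.X), p (R.act g x) = M.act g (p x)) ∧
    (∀ (g : G) (m : M.X), q (M.act g m) = S.act g (q m)) ∧
    (∀ x : R.X, q (p x) = φ.f x) ∧
    (∀ x y : R.X, dist (p x) (p y) ≤ dist x y) ∧
    (∀ m m' : M.X, dist (q m) (q m') ≤ dist m m') ∧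
    ∀ x y : R.X, p x = p y ↔ (φ.f x = φ.f y ∧
      ∀ z : R.X, R.Btw x z y → dist (φ.f z) (φ.f x) ≤ t)

/-- `P` is the basepoint of `R` determined by `g` and `h` (the endpoint of the
intersection of the two characteristic sets, resp. the projection of one onto the other),
characterized by the metric system (1) of [Guirardel–Levitt]. -/
noncomputable def IsBasepoint (R : RGTree G) (g h : G) (P : R.X) : Prop :=
  dist P (R.act g P) = R.ell g ∧
  dist P (R.act h P) = R.ell h + 2 * R.axesDist g h ∧
  dist (R.act g P) (R.act h P) = R.ell g + R.ell h + 2 * R.axesDist g h ∧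
  dist (R.act g P) (R.act h⁻¹ P) = R.ell g + R.ell h + 2 * R.axesDist g h

/-- `p` is a projection of `x` to the set `S` (a closest point of `S`). -/
def IsProj (R : RGTree G) (x : R.X) (S : Set R.X) (p : R.X) : Prop :=
  p ∈ S ∧ ∀ q ∈ S, dist x p ≤ dist x q

/-- Equivariant isometry of `ℝ`-trees. -/
def RIsom (R R' : RGTree G) : Prop :=
  ∃ e : R.X ≃ R'.X, (∀ (g : G) (x : R.X), e (R.act g x) = R'.act g (e x)) ∧
    ∀ x y : R.X, dist (e x) (e y) = dist x y

/-- Equivariant homothety of `ℝ`-trees, with ratio `c`. -/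
def RHomothety (c : ℝ) (R R' : RGTree G) : Prop :=
  ∃ e : R.X ≃ R'.X, (∀ (g : G) (x : R.X), e (R.act g x) = R'.act g (e x)) ∧
    ∀ x y : R.X, dist (e x) (e y) = c * dist x y

end RealTrees
section MoreDefs

variable {G : Type u} [Group G]

/-- `H` is contained in a conjugate of `K`. -/
def ConjLe (H K : Subgroup G) : Prop := ∃ g : G, ∀ h ∈ H, g * h * g⁻¹ ∈ K

/-- `H` represents a maximal element of the vertical set `ℳ` associated to the
deformation space of `T₀`. -/
def MaxVert (T₀ : GTree G) (H : Subgroup G) : Prop :=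
  T₀.Elliptic H ∧ ∀ K : Subgroup G, T₀.Elliptic K → ConjLe H K → ConjLe K H

/-- The vertical set `ℳ`: equivalence classes of maximal elements for containment in a
conjugate, among elliptic subgroups. -/
def vertSet (T₀ : GTree G) : Type u :=
  Quot (fun H K : {H : Subgroup G // MaxVert T₀ H} => ConjLe H.1 K.1 ∧ ConjLe K.1 H.1)

namespace GTree

variable (T : GTree G)

/-- The set of `G`-orbits of vertices (the vertices of the quotient graph `T/G`). -/
def vertexOrbits : Type u := Quot (fun u v : T.V => ∃ g : G, T.act g u = v)

/-- Orbits of neighbours of `v` under the stabilizer of `v`: the oriented edges of the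
quotient graph of groups issued from the image of `v`, whose number is the valence of
the image of `v`. -/
def nbrOrbits (v : T.V) : Type u :=
  Quot (fun a b : {w : T.V // T.graph.Adj v w} => ∃ g : G, T.act g v = v ∧ T.act g a.1 = b.1)

/-- The set of `G`-orbits of (non-oriented) edges. -/
def edgeOrbits : Type u :=
  Quot (fun d d' : T.graph.Dart => ∃ g : G, T.dartAct g d = d' ∨ T.dartAct g d = d'.symm)

/-- BF-reduced: if an edge-to-vertex inclusion `G_e → G_u` is onto, then the image of `u`
in the quotient graph has valence at least 3. -/
def BFReduced : Prop :=
  ∀ u w : T.V, T.graph.Adj u w → T.stab u ≤ T.stab w →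
    3 ≤ Cardinal.mk (T.nbrOrbits u)

end GTree

/-- The quotient graph of groups of `T` has a strict ascending loop: an edge whose
endpoints are in the same orbit, exactly one of the two edge-to-vertex inclusions
being onto. -/
def HasSAL (T : GTree G) : Prop :=
  ∃ u v : T.V, T.graph.Adj u v ∧ (∃ g : G, T.act g u = v) ∧
    Xor' (T.stab u ≤ T.stab v) (T.stab v ≤ T.stab u)

/-- The edge (orbit of) `uv` is a surviving edge: `T` can be made reduced by a collapse
(within its deformation space) not collapsing `uv`. -/
def Surviving (T : GTree G) (u v : T.V) : Prop :=
  ∃ (T' : GTree G) (c : T.V → T'.V), IsCollapseMap T T' c ∧ SameDef T T' ∧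
    T'.Reduced ∧ c u ≠ c v

/-- Containment in a conjugate by an element of `G₀`. -/
def perLe (G₀ : Subgroup G) (H K : Subgroup G) : Prop :=
  ∃ g ∈ G₀, ∀ h ∈ H, g * h * g⁻¹ ∈ K

/-- `H` represents a maximal element of the peripheral structure `ℳ₀` of `G₀`. -/
def PeriphMax (T₀ : GTree G) (G₀ : Subgroup G) (H : Subgroup G) : Prop :=
  H ≤ G₀ ∧ Amin T₀ H ∧
    ∀ K : Subgroup G, K ≤ G₀ → Amin T₀ K → perLe G₀ H K → perLe G₀ K H

/-- The peripheral structure `ℳ₀` of `G₀`, as a set of equivalence classes. -/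
def periphSet (T₀ : GTree G) (G₀ : Subgroup G) : Type u :=
  Quot (fun H K : {H : Subgroup G // PeriphMax T₀ G₀ H} =>
    perLe G₀ H.1 K.1 ∧ perLe G₀ K.1 H.1)

end MoreDefs

namespace RGTree

variable {G : Type u} [Group G] (R : RGTree G)

lemma glue_lemma {y : R.X} (f g : ℝ → R.X) (d1 d2 : ℝ) (hd1 : 0 ≤ d1) (hd2 : 0 ≤ d2)
    (hf0 : f 0 = y) (hg0 : g 0 = y)
    (hf : ∀ s ∈ Set.Icc (0:ℝ) d1, ∀ t ∈ Set.Icc (0:ℝ) d1, dist (f s) (f t) = |s - t|)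
    (hg : ∀ s ∈ Set.Icc (0:ℝ) d2, ∀ t ∈ Set.Icc (0:ℝ) d2, dist (g s) (g t) = |s - t|) :
    ∃ s, 0 ≤ s ∧ s ≤ d1 ∧ s ≤ d2 ∧ f s = g s ∧
      dist (f d1) (f s) + dist (f s) (g d2) = dist (f d1) (g d2) := by
  set S : Set ℝ := {s | s ∈ Set.Icc (0:ℝ) (min d1 d2) ∧ f s = g s} with hS
  have hfc : ContinuousOn f (Set.Icc 0 (min d1 d2)) := by
    have : LipschitzOnWith 1 f (Set.Icc 0 (min d1 d2)) := by
      apply LipschitzOnWith.of_dist_le_mul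
      intro a ha b hb
      rw [hf a ⟨ha.1, ha.2.trans (min_le_left _ _)⟩ b ⟨hb.1, hb.2.trans (min_le_left _ _)⟩]
      simp [Real.dist_eq]
    exact this.continuousOn
  have hgc : ContinuousOn g (Set.Icc 0 (min d1 d2)) := by
    have : LipschitzOnWith 1 g (Set.Icc 0 (min d1 d2)) := by
      apply LipschitzOnWith.of_dist_le_mul
      intro a ha b hb
      rw [hg a ⟨ha.1, ha.2.trans (min_le_right _ _)⟩ b ⟨hb.1, hb.2.trans (min_le_right _ _)⟩]
      simp [Real.dist_eq]
    exact this.continuousOn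
  have hSc : IsCompact S := by
    have hcl : IsClosed S := by
      have h1 : ContinuousOn (fun s => dist (f s) (g s)) (Set.Icc 0 (min d1 d2)) :=
        continuous_dist.comp_continuousOn (hfc.prodMk hgc)
      have h2 := h1.preimage_isClosed_of_isClosed isClosed_Icc (isClosed_singleton (x := (0:ℝ)))
      have : S = Set.Icc 0 (min d1 d2) ∩ (fun s => dist (f s) (g s)) ⁻¹' {0} := by
        ext s; simp [hS]
      rw [this]; exact h2
    exact IsCompact.of_isClosed_subset isCompact_Icc hcl (fun s hs => hs.1)
  have hSn : S.Nonempty := ⟨0, ⟨le_refl _, le_min hd1 hd2⟩, by rw [hf0, hg0]⟩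
  obtain ⟨s, hsS, hsmax⟩ := hSc.exists_isGreatest hSn
  have hs0 : 0 ≤ s := hsS.1.1
  have hs1 : s ≤ d1 := hsS.1.2.trans (min_le_left _ _)
  have hs2 : s ≤ d2 := hsS.1.2.trans (min_le_right _ _)
  have hfg : f s = g s := hsS.2
  refine ⟨s, hs0, hs1, hs2, hfg, ?_⟩
  have hyf : ∀ a ∈ Set.Icc (0:ℝ) d1, dist y (f a) = a := by
    intro a ha
    rw [← hf0, hf 0 ⟨le_refl _, hd1⟩ a ha, zero_sub, abs_neg, abs_of_nonneg ha.1]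
  have hyg : ∀ a ∈ Set.Icc (0:ℝ) d2, dist y (g a) = a := by
    intro a ha
    rw [← hg0, hg 0 ⟨le_refl _, hd2⟩ a ha, zero_sub, abs_neg, abs_of_nonneg ha.1]
  set Lt : ℝ := (d1 - s) + (d2 - s) with hLt
  by_cases hL0 : Lt ≤ 0
  · have h1 : d1 = s := by linarith
    have h2 : d2 = s := by linarith
    rw [h1, h2, ← hfg]; simp
  push Not at hL0
  set k : ℝ → R.X := fun r => if r ≤ d1 - s then f (d1 - r) else g (r - d1 + 2 * s) with hk
  have hkl : ∀ a b, 0 ≤ a → a ≤ b → b ≤ Lt → dist (k a) (k b) ≤ b - a := by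
    intro a b ha hab hb
    simp only [hk]
    by_cases h1 : a ≤ d1 - s
    · by_cases h2 : b ≤ d1 - s
      · rw [if_pos h1, if_pos h2, hf _ ⟨by linarith, by linarith⟩ _ ⟨by linarith, by linarith⟩]
        rw [abs_of_nonneg (by linarith)]; linarith
      · rw [if_pos h1, if_neg h2]
        push Not at h2
        have e1 := hf (d1 - a) ⟨by linarith, by linarith⟩ s ⟨by linarith, by linarith⟩
        have e2 := hg s ⟨by linarith, by linarith⟩ (b - d1 + 2 * s) ⟨by linarith, by linarith⟩
        rw [abs_of_nonneg (by linarith)] at e1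
        rw [abs_of_nonpos (by linarith)] at e2
        rw [hfg] at e1
        have := dist_triangle (f (d1 - a)) (g s) (g (b - d1 + 2 * s))
        linarith
    · rw [if_neg h1, if_neg (by intro h; exact h1 (hab.trans h))]
      push Not at h1
      rw [hg _ ⟨by linarith, by linarith⟩ _ ⟨by linarith, by linarith⟩]
      rw [abs_of_nonpos (by linarith)]; linarith
  have hki : ∀ a b, 0 ≤ a → a < b → b ≤ Lt → k a ≠ k b := by
    intro a b ha hab hb
    simp only [hk]
    by_cases h1 : a ≤ d1 - s
    · by_cases h2 : b ≤ d1 - s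
      · rw [if_pos h1, if_pos h2, ← dist_pos,
          hf _ ⟨by linarith, by linarith⟩ _ ⟨by linarith, by linarith⟩]
        rw [abs_of_nonneg (by linarith)]; linarith
      · rw [if_pos h1, if_neg h2]
        push Not at h2
        intro heq
        have e1 := hyf (d1 - a) ⟨by linarith, by linarith⟩
        have e2 := hyg (b - d1 + 2 * s) ⟨by linarith, by linarith⟩
        rw [heq, e2] at e1
        have hmem : d1 - a ∈ S := by
          refine ⟨⟨by linarith, le_min (by linarith) (by linarith)⟩, ?_⟩
          rw [heq, e1]
        have := hsmax hmem
        linarith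
    · rw [if_neg h1, if_neg (by intro h; exact h1 (hab.le.trans h))]
      push Not at h1
      rw [← dist_pos, hg _ ⟨by linarith, by linarith⟩ _ ⟨by linarith, by linarith⟩]
      rw [abs_of_nonpos (by linarith)]; linarith
  have hkx : k 0 = f d1 := by simp only [hk]; rw [if_pos (by linarith)]; simp
  have hkz : k Lt = g d2 := by
    simp only [hk]
    split_ifs with h1
    · have : d2 = s := by linarith
      rw [this, ← hfg]; congr 1; linarith
    · congr 1; linarith
  have hks : k (d1 - s) = f s := by simp only [hk]; rw [if_pos (le_refl _)]; congr 1; linarith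
  refine R.unique_arc (f d1) (g d2) (fun τ => k (τ.1 * Lt)) ?_ ?_ ?_ ?_ (f s) ?_
  · have : LipschitzWith (Real.toNNReal Lt) (fun τ : Set.Icc (0:ℝ) 1 => k (τ.1 * Lt)) := by
      apply LipschitzWith.of_dist_le_mul
      intro a b
      rw [Real.coe_toNNReal _ hL0.le, Subtype.dist_eq, Real.dist_eq]
      have ha := a.2; have hb := b.2
      rcases le_total a.1 b.1 with h | h
      · have := hkl (a.1 * Lt) (b.1 * Lt) (mul_nonneg ha.1 hL0.le)
          (mul_le_mul_of_nonneg_right h hL0.le) (by nlinarith [hb.2])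
        rw [abs_of_nonpos (by linarith)]; nlinarith
      · have := hkl (b.1 * Lt) (a.1 * Lt) (mul_nonneg hb.1 hL0.le)
          (mul_le_mul_of_nonneg_right h hL0.le) (by nlinarith [ha.2])
        rw [dist_comm] at this
        rw [abs_of_nonneg (by linarith)]; nlinarith
    exact this.continuous
  · intro a b hab
    have ha := a.2; have hb := b.2
    rcases lt_trichotomy a.1 b.1 with h | h | h
    · exact absurd hab (hki _ _ (mul_nonneg ha.1 hL0.le) (mul_lt_mul_of_pos_right h hL0)
        (by nlinarith [hb.2]))
    · exact Subtype.ext h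
    · exact absurd hab.symm (hki _ _ (mul_nonneg hb.1 hL0.le) (mul_lt_mul_of_pos_right h hL0)
        (by nlinarith [ha.2]))
  · simp [hkx]
  · simp [hkz]
  · refine ⟨⟨(d1 - s) / Lt, div_nonneg (by linarith) hL0.le,
      (div_le_one hL0).2 (by linarith)⟩, ?_⟩
    simp only
    rw [div_mul_cancel₀ _ hL0.ne', hks]

/-- The four point condition. -/
lemma four_point (x y z w : R.X) :
    dist x y + dist z w ≤ dist x z + dist y w ∨ dist x y + dist z w ≤ dist x w + dist y z := by
  obtain ⟨f, hf0, hf1, hf⟩ := R.geodesic y x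
  obtain ⟨g, hg0, hg1, hg⟩ := R.geodesic y z
  obtain ⟨h, hh0, hh1, hh⟩ := R.geodesic y w
  obtain ⟨a, a0, a1, a2, a3, a4⟩ := R.glue_lemma f g _ _ dist_nonneg dist_nonneg hf0 hg0 hf hg
  obtain ⟨b, b0, b1, b2, b3, b4⟩ := R.glue_lemma f h _ _ dist_nonneg dist_nonneg hf0 hh0 hf hh
  rw [hf1, hg1] at a4
  rw [hf1, hh1] at b4
  have e1 := hf a ⟨a0, a1⟩ b ⟨b0, b1⟩
  have e2 := hf a ⟨a0, a1⟩ _ ⟨dist_nonneg, le_refl _⟩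
  have e3 := hf b ⟨b0, b1⟩ _ ⟨dist_nonneg, le_refl _⟩
  have e4 := hg a ⟨a0, a2⟩ _ ⟨dist_nonneg, le_refl _⟩
  have e5 := hh b ⟨b0, b2⟩ _ ⟨dist_nonneg, le_refl _⟩
  rw [hf1] at e2 e3
  rw [hg1, ← a3] at e4
  rw [hh1, ← b3] at e5
  rw [abs_of_nonpos (by linarith)] at e2 e3 e4 e5
  have t1 := dist_triangle z (f a) w
  have t2 := dist_triangle (f a) (f b) w
  rw [dist_comm z (f a)] at t1
  rw [dist_comm x (f a)] at a4
  rw [dist_comm x (f b)] at b4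
  have c1 := dist_comm x y
  rcases le_total a b with hab | hab
  · left
    rw [abs_of_nonpos (by linarith)] at e1
    linarith
  · right
    rw [abs_of_nonneg (by linarith)] at e1
    linarith

variable {R}

lemma btw_symm {x z y : R.X} (h : R.Btw x z y) : R.Btw y z x := by
  unfold Btw at *
  rw [dist_comm y z, dist_comm z x, dist_comm y x]; linarith

lemma btw_left (x y : R.X) : R.Btw x x y := by simp [Btw]
lemma btw_right (x y : R.X) : R.Btw x y y := by simp [Btw]

lemma btw_self {x z : R.X} (h : R.Btw x z x) : z = x := by
  unfold Btw at h
  rw [dist_self, dist_comm z x] at h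
  have : dist x z = 0 := by linarith
  exact (dist_eq_zero.1 this).symm

lemma exists_point (x y : R.X) (s : ℝ) (h0 : 0 ≤ s) (h1 : s ≤ dist x y) :
    ∃ p, R.Btw x p y ∧ dist x p = s := by
  obtain ⟨f, hf0, hf1, hf⟩ := R.geodesic x y
  refine ⟨f s, ?_, ?_⟩
  · have e1 := hf 0 ⟨le_refl _, dist_nonneg⟩ s ⟨h0, h1⟩
    have e2 := hf s ⟨h0, h1⟩ _ ⟨dist_nonneg, le_refl _⟩
    rw [hf0, abs_of_nonpos (by linarith)] at e1
    rw [hf1, abs_of_nonpos (by linarith)] at e2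
    unfold Btw; linarith
  · have e1 := hf 0 ⟨le_refl _, dist_nonneg⟩ s ⟨h0, h1⟩
    rw [hf0, abs_of_nonpos (by linarith)] at e1
    linarith

/-- Two points of a segment: the distance. -/
lemma dist_of_btw {x y p q : R.X} (hp : R.Btw x p y) (hq : R.Btw x q y) :
    dist p q = |dist x p - dist x q| := by
  unfold Btw at *
  have t1 := dist_triangle x p q
  have t2 := dist_triangle x q p
  rw [dist_comm q p] at t2
  have h := R.four_point x y p q
  have c1 := dist_comm p y
  have c2 := dist_comm q y
  apply le_antisymm
  · rw [le_abs]
    rcases h with h | h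
    · left; linarith
    · right; linarith
  · rw [abs_le]; constructor <;> linarith

lemma btw_unique {x y p q : R.X} (hp : R.Btw x p y) (hq : R.Btw x q y)
    (h : dist x p = dist x q) : p = q := by
  have := dist_of_btw hp hq
  rw [h, sub_self, abs_zero] at this
  exact dist_eq_zero.1 this

/-- order on a segment -/
lemma btw_of_le {x y p q : R.X} (hp : R.Btw x p y) (hq : R.Btw x q y)
    (h : dist x p ≤ dist x q) : R.Btw x p q ∧ R.Btw p q y := by
  have := dist_of_btw hp hq
  rw [abs_of_nonpos (by linarith)] at this
  unfold Btw at *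
  constructor <;> linarith

lemma btw_total {x y p q : R.X} (hp : R.Btw x p y) (hq : R.Btw x q y) :
    (R.Btw x p q ∧ R.Btw p q y) ∨ (R.Btw x q p ∧ R.Btw q p y) := by
  rcases le_total (dist x p) (dist x q) with h | h
  · exact Or.inl (btw_of_le hp hq h)
  · exact Or.inr (btw_of_le hq hp h)

lemma btw_trans_left {x y p q : R.X} (hp : R.Btw x p y) (hq : R.Btw x q p) :
    R.Btw x q y ∧ R.Btw q p y := by
  unfold Btw at *
  have t1 := dist_triangle x q y
  have t2 := dist_triangle q p y
  constructor <;> linarith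

lemma btw_trans_right {x y p q : R.X} (hp : R.Btw x p y) (hq : R.Btw p q y) :
    R.Btw x q y ∧ R.Btw x p q := by
  unfold Btw at *
  have t1 := dist_triangle x q y
  have t2 := dist_triangle x p q
  constructor <;> linarith

/-- segments are convex -/
lemma btw_convex {a b x y z : R.X} (hx : R.Btw a x b) (hy : R.Btw a y b) (hz : R.Btw x z y) :
    R.Btw a z b := by
  rcases btw_total hx hy with ⟨h1, h2⟩ | ⟨h1, h2⟩
  · exact (btw_trans_left hy (btw_trans_right h1 hz).1).1
  · exact (btw_trans_left hx (btw_trans_right h1 (btw_symm hz)).1).1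

/-- local geodesics are geodesics -/
lemma btw_glue {a b c d : R.X} (h1 : R.Btw a b c) (h2 : R.Btw b c d) (hne : b ≠ c) :
    R.Btw a b d ∧ R.Btw a c d := by
  unfold Btw at *
  have hp := dist_pos.2 hne
  have h := R.four_point a c b d
  have t1 := dist_triangle a b d
  have t2 := dist_triangle a c d
  have c1 := dist_comm c b
  have c2 := dist_comm c d
  rcases h with h | h
  · linarith
  · constructor <;> linarith

/-- tripod: a segment is in the union of the two other sides of a triangle -/
lemma btw_tripod {x y z : R.X} (hz : R.Btw x z y) (w : R.X) : R.Btw x z w ∨ R.Btw w z y := by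
  unfold Btw at *
  have h := R.four_point x y z w
  have t1 := dist_triangle x z w
  have t2 := dist_triangle w z y
  have c1 := dist_comm w z
  have c2 := dist_comm z y
  have c3 := dist_comm w y
  rcases h with h | h
  · right; linarith
  · left; linarith

lemma exists_median (x y z : R.X) : ∃ m, R.Btw x m y ∧ R.Btw y m z ∧ R.Btw x m z := by
  obtain ⟨f, hf0, hf1, hf⟩ := R.geodesic y x
  obtain ⟨g, hg0, hg1, hg⟩ := R.geodesic y z
  obtain ⟨a, a0, a1, a2, a3, a4⟩ := R.glue_lemma f g _ _ dist_nonneg dist_nonneg hf0 hg0 hf hg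
  rw [hf1, hg1] at a4
  have e2 := hf a ⟨a0, a1⟩ _ ⟨dist_nonneg, le_refl _⟩
  have e4 := hg a ⟨a0, a2⟩ _ ⟨dist_nonneg, le_refl _⟩
  have e5 := hf 0 ⟨le_refl _, dist_nonneg⟩ a ⟨a0, a1⟩
  rw [hf1] at e2
  rw [hg1, ← a3] at e4
  rw [hf0] at e5
  rw [abs_of_nonpos (by linarith)] at e2 e4 e5
  refine ⟨f a, ?_, ?_, ?_⟩
  · unfold Btw
    rw [dist_comm x, dist_comm (f a) y, dist_comm x y]; linarith
  · unfold Btw; linarith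
  · unfold Btw; exact a4

/-- convexity of distance -/
lemma dist_le_of_btw {u z v : R.X} (h : R.Btw u z v) (o : R.X) (t : ℝ) (h1 : dist u o ≤ t)
    (h2 : dist v o ≤ t) : dist z o ≤ t := by
  unfold Btw at *
  have h := R.four_point u v z o
  have c2 := dist_comm z v
  have p1 := dist_nonneg (x := u) (y := z)
  have p2 := dist_nonneg (x := v) (y := z)
  rcases h with h | h <;> linarith

/-- same direction at `m` is transitive -/
lemma dir_trans {m u v w : R.X} (h1 : ¬ R.Btw u m v) (h2 : ¬ R.Btw v m w) : ¬ R.Btw u m w := by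
  intro h
  rcases btw_tripod h v with h | h
  · exact h1 h
  · exact h2 h

lemma dir_symm {m u v : R.X} (h1 : ¬ R.Btw u m v) : ¬ R.Btw v m u := fun h => h1 (btw_symm h)

lemma dist_act (g : G) (x y : R.X) : dist (R.act g x) (R.act g y) = dist x y :=
  (R.isom g).dist_eq x y

lemma btw_act (g : G) {x y z : R.X} (h : R.Btw x z y) :
    R.Btw (R.act g x) (R.act g z) (R.act g y) := by
  unfold Btw at *
  rw [dist_act, dist_act, dist_act]; exact h

lemma act_inv_act (g : G) (x : R.X) : R.act g⁻¹ (R.act g x) = x := by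
  rw [← Equiv.Perm.mul_apply, ← map_mul, inv_mul_cancel, map_one, Equiv.Perm.one_apply]

lemma act_act_inv (g : G) (x : R.X) : R.act g (R.act g⁻¹ x) = x := by
  rw [← Equiv.Perm.mul_apply, ← map_mul, mul_inv_cancel, map_one, Equiv.Perm.one_apply]

lemma btw_act_iff (g : G) {x y z : R.X} :
    R.Btw (R.act g x) (R.act g z) (R.act g y) ↔ R.Btw x z y := by
  unfold Btw
  rw [dist_act, dist_act, dist_act]

/-- The geodesic lifts: a map isometric on a segment. -/
lemma iso_lift {R S : RGTree G} (f : R.X → S.X) {a b : R.X}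
    (hf : ∀ p q, R.Btw a p b → R.Btw a q b → dist (f p) (f q) = dist p q)
    {w : S.X} (hw : S.Btw (f a) w (f b)) : ∃ z, R.Btw a z b ∧ f z = w := by
  have hab := hf a b (btw_left _ _) (btw_right _ _)
  obtain ⟨z, hz, hd⟩ := exists_point (R := R) a b (dist (f a) w) dist_nonneg (by
    unfold Btw at hw; have := dist_nonneg (x := w) (y := f b); linarith)
  refine ⟨z, hz, ?_⟩
  have h1 := hf a z (btw_left _ _) hz
  have h2 := hf z b hz (btw_right _ _)
  refine btw_unique (x := f a) (y := f b) ?_ hw ?_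
  · unfold Btw at *; linarith
  · linarith

/-- A map isometric on a segment preserves betweenness in it. -/
lemma iso_btw {R S : RGTree G} (f : R.X → S.X) {a b : R.X}
    (hf : ∀ p q, R.Btw a p b → R.Btw a q b → dist (f p) (f q) = dist p q)
    {x y z : R.X} (hx : R.Btw a x b) (hy : R.Btw a y b) (hz : R.Btw a z b) :
    S.Btw (f x) (f y) (f z) ↔ R.Btw x y z := by
  unfold Btw at *
  rw [hf x y hx hy, hf y z hy hz, hf x z hx hz]

end RGTree

namespace RGTree

variable {G : Type u} [Group G] {R : RGTree G}

/-- A simplicial structure on an `ℝ`-tree, given by its vertex set. -/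
structure Simpl (R : RGTree G) (W : Set R.X) : Prop where
  inv : ∀ (g : G) (x : R.X), x ∈ W → R.act g x ∈ W
  fin : ∀ x y : R.X, {w : R.X | w ∈ W ∧ R.Btw x w y}.Finite
  branch : ∀ m x y z : R.X, R.Btw x m y → R.Btw y m z → R.Btw x m z → m ≠ x → m ≠ y → m ≠ z →
    m ∈ W
  cover : ∀ x : R.X, ∃ u ∈ W, ∃ v ∈ W, R.Btw u x v

/-- `a,b` are consecutive (possibly equal) vertices. -/
def Edge (R : RGTree G) (W : Set R.X) (a b : R.X) : Prop :=
  a ∈ W ∧ b ∈ W ∧ ∀ w ∈ W, R.Btw a w b → w = a ∨ w = b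

lemma Edge.symm {W : Set R.X} {a b : R.X} (h : R.Edge W a b) : R.Edge W b a :=
  ⟨h.2.1, h.1, fun w hw hb => (h.2.2 w hw (btw_symm hb)).symm⟩

lemma Edge.act {W : Set R.X} (hW : ∀ (g : G) (x : R.X), x ∈ W → R.act g x ∈ W) {a b : R.X}
    (h : R.Edge W a b) (g : G) : R.Edge W (R.act g a) (R.act g b) := by
  refine ⟨hW g a h.1, hW g b h.2.1, fun w hw hb => ?_⟩
  have := h.2.2 (R.act g⁻¹ w) (hW _ _ hw) (by
    have := btw_act g⁻¹ hb
    rwa [act_inv_act, act_inv_act] at this)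
  rcases this with h | h
  · left; rw [← h, act_act_inv]
  · right; rw [← h, act_act_inv]

lemma btw_antisymm {a x y : R.X} (h1 : R.Btw a x y) (h2 : R.Btw a y x) : x = y := by
  unfold Btw at *
  have c := dist_comm x y
  have : dist x y = 0 := by linarith
  exact dist_eq_zero.1 this

lemma consec {W : Set R.X} (hfin : ∀ x y : R.X, {w : R.X | w ∈ W ∧ R.Btw x w y}.Finite)
    (u v : R.X) (hu : u ∈ W) (hv : v ∈ W) (x : R.X) (hx : R.Btw u x v) :
    ∃ a b, R.Edge W a b ∧ R.Btw u a v ∧ R.Btw u b v ∧ R.Btw a x b := by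
  induction hn : (hfin u v).toFinset.card using Nat.strong_induction_on generalizing u v with
  | _ n ih =>
    by_cases he : R.Edge W u v
    · exact ⟨u, v, he, btw_left _ _, btw_right _ _, hx⟩
    · unfold Edge at he
      push Not at he
      obtain ⟨w, hw, hb, hwu, hwv⟩ := he hu hv
      rcases btw_tripod hx w with h | h
      · obtain ⟨a, b, h1, h2, h3, h4⟩ := ih (hfin u w).toFinset.card (by
          rw [← hn]
          apply Finset.card_lt_card
          rw [Finset.ssubset_iff_of_subset]
          · refine ⟨v, ?_, ?_⟩
            · simpa using ⟨hv, btw_right _ _⟩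
            · simp only [Set.Finite.mem_toFinset]
              rintro ⟨_, h''⟩
              exact hwv (btw_antisymm hb h'')
          · intro z hz
            simp only [Set.Finite.mem_toFinset] at hz ⊢
            exact ⟨hz.1, (btw_trans_left hb hz.2).1⟩) u w hu hw h rfl
        exact ⟨a, b, h1, (btw_trans_left hb h2).1, (btw_trans_left hb h3).1, h4⟩
      · obtain ⟨a, b, h1, h2, h3, h4⟩ := ih (hfin w v).toFinset.card (by
          rw [← hn]
          apply Finset.card_lt_card
          rw [Finset.ssubset_iff_of_subset]
          · refine ⟨u, ?_, ?_⟩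
            · simpa using ⟨hu, btw_left _ _⟩
            · simp only [Set.Finite.mem_toFinset]
              rintro ⟨_, h''⟩
              exact hwu (btw_antisymm (btw_symm hb) (btw_symm h''))
          · intro z hz
            simp only [Set.Finite.mem_toFinset] at hz ⊢
            exact ⟨hz.1, (btw_trans_right hb hz.2).1⟩) w v hw hv h rfl
        exact ⟨a, b, h1, (btw_trans_right hb h2).1, (btw_trans_right hb h3).1, h4⟩

lemma Simpl.exists_edge {W : Set R.X} (hW : Simpl R W) (x : R.X) :
    ∃ a b, R.Edge W a b ∧ R.Btw a x b := by
  obtain ⟨u, hu, v, hv, h⟩ := hW.cover x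
  obtain ⟨a, b, h1, _, _, h2⟩ := consec hW.fin u v hu hv x h
  exact ⟨a, b, h1, h2⟩

/-- Edge property: leaving an edge requires going through an endpoint. -/
lemma edge_prop {W : Set R.X}
    (hbr : ∀ m x y z : R.X, R.Btw x m y → R.Btw y m z → R.Btw x m z → m ≠ x → m ≠ y → m ≠ z →
      m ∈ W) {a b : R.X} (he : R.Edge W a b) {z : R.X} (hz : R.Btw a z b) (x : R.X) :
    R.Btw a x b ∨ R.Btw x a z ∨ R.Btw x b z := by
  obtain ⟨m, h1, h2, h3⟩ := exists_median (R := R) x a b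
  by_cases hx : m = x
  · left; rwa [← hx]
  by_cases ha : m = a
  · right; left
    rw [ha] at h3
    exact (btw_trans_right h3 hz).2
  by_cases hb : m = b
  · right; right
    rw [hb] at h1
    exact (btw_trans_right h1 (btw_symm hz)).2
  have := hbr m x a b h1 h2 h3 hx ha hb
  rcases he.2.2 m this h2 with h | h
  · exact absurd h ha
  · exact absurd h hb

/-- if `x` is a vertex -/
lemma edge_prop_vert {W : Set R.X}
    (hbr : ∀ m x y z : R.X, R.Btw x m y → R.Btw y m z → R.Btw x m z → m ≠ x → m ≠ y → m ≠ z →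
      m ∈ W) {a b : R.X} (he : R.Edge W a b) {z : R.X} (hz : R.Btw a z b) {x : R.X} (hx : x ∈ W) :
    R.Btw x a z ∨ R.Btw x b z := by
  rcases edge_prop hbr he hz x with h | h | h
  · rcases he.2.2 x hx h with h | h
    · left; rw [h]; exact btw_left _ _
    · right; rw [h]; exact btw_left _ _
  · exact Or.inl h
  · exact Or.inr h

lemma edge_unique {W : Set R.X}
    (hbr : ∀ m x y z : R.X, R.Btw x m y → R.Btw y m z → R.Btw x m z → m ≠ x → m ≠ y → m ≠ z →
      m ∈ W) {a b c d : R.X} (he : R.Edge W a b) (he' : R.Edge W c d) {w : R.X} (hw : w ∉ W)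
    (h1 : R.Btw a w b) (h2 : R.Btw c w d) : (c = a ∧ d = b) ∨ (c = b ∧ d = a) := by
  have key : ∀ c d, R.Edge W c d → R.Btw c w d → c = a ∨ c = b := by
    intro c d he' h2
    rcases edge_prop_vert hbr he h1 he'.1 with h | h
    · rcases he'.2.2 a he.1 (btw_trans_left h2 h).1 with h' | h'
      · exact Or.inl h'.symm
      · rw [h'] at h
        exact absurd (btw_antisymm h h2 ▸ he'.2.1) hw
    · rcases he'.2.2 b he.2.1 (btw_trans_left h2 h).1 with h' | h'
      · exact Or.inr h'.symm
      · rw [h'] at h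
        exact absurd (btw_antisymm h h2 ▸ he'.2.1) hw
  have hcd : c ≠ d := by
    intro h
    rw [← h] at h2
    exact hw (btw_self h2 ▸ he'.1)
  rcases key c d he' h2 with h | h <;> rcases key d c he'.symm (btw_symm h2) with h' | h'
  · exact absurd (h.trans h'.symm) hcd
  · exact Or.inl ⟨h, h'⟩
  · exact Or.inr ⟨h, h'⟩
  · exact absurd (h.trans h'.symm) hcd

/-- midpoint of a nondegenerate edge is not a vertex -/
lemma edge_mid {W : Set R.X} {a b : R.X} (he : R.Edge W a b) (hne : a ≠ b) :
    ∃ m, R.Btw a m b ∧ dist a m = dist a b / 2 ∧ m ∉ W := by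
  have hp := dist_pos.2 hne
  obtain ⟨m, hm, hd⟩ := exists_point (R := R) a b (dist a b / 2) (by linarith) (by linarith)
  refine ⟨m, hm, hd, fun hmW => ?_⟩
  rcases he.2.2 m hmW hm with h | h
  · rw [h, dist_self] at hd; linarith
  · rw [h] at hd; linarith

section mk


/-- The graph on the vertex set. -/
def wGraph (W : Set R.X) : SimpleGraph {x : R.X // x ∈ W} where
  Adj a b := a ≠ b ∧ R.Edge W a.1 b.1
  symm := ⟨fun a b h => ⟨h.1.symm, h.2.symm⟩⟩
  loopless := ⟨fun a h => h.1 rfl⟩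


lemma wGraph_reach {W : Set R.X} (hW : Simpl R W) (u v : {x : R.X // x ∈ W}) : (wGraph W).Reachable u v := by
  obtain ⟨u, hu⟩ := u
  obtain ⟨v, hv⟩ := v
  induction hn : (hW.fin u v).toFinset.card using Nat.strong_induction_on generalizing u v with
  | _ n ih =>
    by_cases huv : u = v
    · subst huv; exact SimpleGraph.Reachable.refl _
    by_cases he : R.Edge W u v
    · exact SimpleGraph.Adj.reachable (G := wGraph W) ⟨fun h => huv (Subtype.ext_iff.1 h), he⟩
    · unfold Edge at he
      push Not at he
      obtain ⟨w, hw, hb, hwu, hwv⟩ := he hu hv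
      have r1 := ih (hW.fin u w).toFinset.card (by
          rw [← hn]
          apply Finset.card_lt_card
          rw [Finset.ssubset_iff_of_subset]
          · refine ⟨v, ?_, ?_⟩
            · simpa using ⟨hv, btw_right _ _⟩
            · simp only [Set.Finite.mem_toFinset]
              rintro ⟨_, h''⟩
              exact hwv (btw_antisymm hb h'')
          · intro z hz
            simp only [Set.Finite.mem_toFinset] at hz ⊢
            exact ⟨hz.1, (btw_trans_left hb hz.2).1⟩) u hu w hw rfl
      have r2 := ih (hW.fin w v).toFinset.card (by
          rw [← hn]
          apply Finset.card_lt_card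
          rw [Finset.ssubset_iff_of_subset]
          · refine ⟨u, ?_, ?_⟩
            · simpa using ⟨hu, btw_left _ _⟩
            · simp only [Set.Finite.mem_toFinset]
              rintro ⟨_, h''⟩
              exact hwu (btw_antisymm (btw_symm hb) (btw_symm h''))
          · intro z hz
            simp only [Set.Finite.mem_toFinset] at hz ⊢
            exact ⟨hz.1, (btw_trans_right hb hz.2).1⟩) w hw v hv rfl
      exact r1.trans r2

lemma wGraph_step {W : Set R.X} (hW : Simpl R W) {u w w2 : {x : R.X // x ∈ W}} (h1 : (wGraph W).Adj u w)
    (h2 : (wGraph W).Adj w w2) (hne : u ≠ w2) : R.Btw u.1 w.1 w2.1 := by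
  obtain ⟨m, hm1, hm2, hm3⟩ := exists_median (R := R) u.1 w.1 w2.1
  by_cases hu : m = u.1
  · rw [hu] at hm2
    rcases h2.2.2.2 u.1 u.2 hm2 with h | h
    · exact absurd (Subtype.ext h) h1.1
    · exact absurd (Subtype.ext h) hne
  by_cases hw : m = w.1
  · rwa [hw] at hm3
  by_cases hw2 : m = w2.1
  · rw [hw2] at hm1
    rcases h1.2.2.2 w2.1 w2.2 hm1 with h | h
    · exact absurd (Subtype.ext h.symm) hne
    · exact absurd (Subtype.ext h.symm) h2.1
  have := hW.branch m _ _ _ hm1 hm2 hm3 hu hw hw2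
  rcases h1.2.2.2 m this hm1 with h | h
  · exact absurd h hu
  · exact absurd h hw

lemma wGraph_path {W : Set R.X} (hW : Simpl R W) {u w v : {x : R.X // x ∈ W}} (h : (wGraph W).Adj u w) (p : (wGraph W).Walk w v)
    (hp : (SimpleGraph.Walk.cons h p).IsPath) : R.Btw u.1 w.1 v.1 := by
  induction p generalizing u with
  | nil => exact btw_right _ _
  | @cons a b c h2 p ih =>
    have hp' := (SimpleGraph.Walk.cons_isPath_iff h _).1 hp
    have hb := ih h2 hp'.1
    have : u ≠ b := by
      intro he
      apply hp'.2
      rw [he]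
      simp
    have hs := wGraph_step hW h h2 this
    exact (btw_glue hs hb (fun e => h2.1 (Subtype.ext e))).1

lemma wGraph_unique {W : Set R.X} (hW : Simpl R W) {u v : {x : R.X // x ∈ W}} (p q : (wGraph W).Walk u v)
    (hp : p.IsPath) (hq : q.IsPath) : p = q := by
  induction p with
  | nil =>
    cases q with
    | nil => rfl
    | cons h q =>
      have := ((SimpleGraph.Walk.cons_isPath_iff h _).1 hq).2
      exact absurd (SimpleGraph.Walk.end_mem_support q) this
  | @cons a b c h p ih =>
    cases q with
    | nil =>
      have := ((SimpleGraph.Walk.cons_isPath_iff h _).1 hp).2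
      exact absurd (SimpleGraph.Walk.end_mem_support p) this
    | @cons _ b' _ h' q =>
      have e1 := wGraph_path hW h p hp
      have e2 := wGraph_path hW h' q hq
      have hbb : b = b' := by
        rcases btw_total e1 e2 with ⟨k, _⟩ | ⟨k, _⟩
        · rcases h'.2.2.2 b.1 b.2 k with k | k
          · exact absurd (Subtype.ext k.symm) h.1
          · exact Subtype.ext k
        · rcases h.2.2.2 b'.1 b'.2 k with k | k
          · exact absurd (Subtype.ext k.symm) h'.1
          · exact Subtype.ext k.symm
      subst hbb
      rw [ih q ((SimpleGraph.Walk.cons_isPath_iff h _).1 hp).1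
        ((SimpleGraph.Walk.cons_isPath_iff h' _).1 hq).1]

lemma wGraph_mem_support {W : Set R.X} (_hW : Simpl R W) {u v : {x : R.X // x ∈ W}} (p : (wGraph W).Walk u v)
    (hp : p.IsPath) (w : {x : R.X // x ∈ W}) (hw : R.Btw u.1 w.1 v.1) : w ∈ p.support := by
  induction p with
  | nil =>
    have := btw_self hw
    simp [Subtype.ext this]
  | @cons a b c h p ih =>
    have hp' := (SimpleGraph.Walk.cons_isPath_iff h _).1 hp
    rcases btw_tripod hw b.1 with k | k
    · rcases h.2.2.2 w.1 w.2 k with k | k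
      · rw [Subtype.ext k]; simp
      · rw [Subtype.ext k]; simp
    · simp only [SimpleGraph.Walk.support_cons, List.mem_cons]
      right; exact ih hp'.1 k

lemma wGraph_len {W : Set R.X} (hW : Simpl R W) {u v : {x : R.X // x ∈ W}} (p : (wGraph W).Walk u v)
    (hp : p.IsPath) : (p.darts.map fun d => dist d.toProd.1.1 d.toProd.2.1).sum = dist u.1 v.1 := by
  induction p with
  | nil => simp
  | @cons a b c h p ih =>
    have hp' := (SimpleGraph.Walk.cons_isPath_iff h _).1 hp
    have e1 := wGraph_path hW h p hp
    simp only [SimpleGraph.Walk.darts_cons, List.map_cons, List.sum_cons]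
    rw [ih hp'.1]
    exact e1

lemma wGraph_isTree {W : Set R.X} (hW : Simpl R W) : (wGraph W).IsTree := by
  constructor
  · haveI : Nonempty {x : R.X // x ∈ W} := by
      obtain ⟨x, _⟩ := R.nontrivial.exists_pair_ne
      obtain ⟨u, hu, _⟩ := hW.cover x
      exact ⟨⟨u, hu⟩⟩
    exact ⟨fun u v => wGraph_reach hW u v⟩
  · apply SimpleGraph.isAcyclic_of_path_unique
    intro u v p q
    exact Subtype.ext (wGraph_unique hW p.1 q.1 p.2 q.2)

lemma wGraph_minimal {W : Set R.X} (hW : Simpl R W) (S : Set {x : R.X // x ∈ W}) (hS : S.Nonempty)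
    (hinv : ∀ (g : G), ∀ v ∈ S, (⟨R.act g v.1, hW.inv g v.1 v.2⟩ : {x : R.X // x ∈ W}) ∈ S)
    (hpath : ∀ u ∈ S, ∀ v ∈ S, ∀ p : (wGraph W).Walk u v, p.IsPath → ∀ w ∈ p.support, w ∈ S) :
    S = Set.univ := by
  have key := R.minimal {x | ∃ u ∈ S, ∃ v ∈ S, R.Btw u.1 x v.1} (by
      obtain ⟨s, hs⟩ := hS
      exact ⟨s.1, s, hs, s, hs, btw_left _ _⟩) (by
      rintro g x ⟨u, hu, v, hv, h⟩
      exact ⟨_, hinv g u hu, _, hinv g v hv, btw_act g h⟩) (by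
      rintro x ⟨u, hu, v, hv, h⟩ y ⟨u', hu', v', hv', h'⟩ z hz
      rcases btw_tripod (R := R) hz u.1 with k | k
      · exact ⟨u, hu, v, hv, btw_convex h (btw_left _ _) k⟩
      · rcases btw_tripod (R := R) k u'.1 with k | k
        · exact ⟨u, hu, u', hu', k⟩
        · exact ⟨u', hu', v', hv', btw_convex (btw_left _ _) h' k⟩)
  ext w
  simp only [Set.mem_univ, iff_true]
  have hw : w.1 ∈ {x | ∃ u ∈ S, ∃ v ∈ S, R.Btw u.1 x v.1} := by rw [key]; trivial
  obtain ⟨u, hu, v, hv, h⟩ := hw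
  obtain ⟨p, hp⟩ := (wGraph_reach hW u v).exists_isPath
  exact hpath u hu v hv p hp w (wGraph_mem_support hW p hp w h)

/-- The simplicial tree. -/
noncomputable def mkTree {W : Set R.X} (hW : Simpl R W) (hni : ∀ (g : G) (a b : R.X), R.Edge W a b → a ≠ b → R.act g a = b →
    R.act g b = a → False) : MGTree G where
  V := {x : R.X // x ∈ W}
  nonempty := (wGraph_isTree hW).1.nonempty
  graph := wGraph W
  isTree := wGraph_isTree hW
  act := 
    { toFun := fun g => 
        { toFun := fun x => ⟨R.act g x.1, hW.inv g x.1 x.2⟩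
          invFun := fun x => ⟨R.act g⁻¹ x.1, hW.inv g⁻¹ x.1 x.2⟩
          left_inv := fun x => Subtype.ext (act_inv_act g x.1)
          right_inv := fun x => Subtype.ext (act_act_inv g x.1) }
      map_one' := by ext x; simp
      map_mul' := by intro g h; ext x; simp }
  adj_act := fun g u v h => ⟨fun e => h.1 (Subtype.ext ((R.act g).injective
    (Subtype.ext_iff.1 e))), Edge.act hW.inv h.2 g⟩
  noInversion := fun g u v h hh => hni g u.1 v.1 h.2 (fun e => h.1 (Subtype.ext e))
    (Subtype.ext_iff.1 hh.1) (Subtype.ext_iff.1 hh.2)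
  minimal := fun S h1 h2 h3 => wGraph_minimal hW S h1 h2 h3
  len := fun u v => dist u.1 v.1
  len_symm := fun u v => dist_comm _ _
  len_pos := fun u v h => dist_pos.2 (fun e => h.1 (Subtype.ext e))
  len_equivariant := fun g u v => dist_act g u.1 v.1

lemma mkTree_real {W : Set R.X} (hW : Simpl R W) (hni : ∀ (g : G) (a b : R.X), R.Edge W a b → a ≠ b → R.act g a = b →
    R.act g b = a → False) : RealizationOf R (mkTree hW hni) := by
  refine ⟨fun x => x.1, fun g v => rfl, fun u v => ?_, fun x => ?_⟩
  · have : {x : ℝ | ∃ p : (mkTree hW hni).graph.Walk u v, p.IsPath ∧ x = (mkTree hW hni).walkLen p}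
        = {dist u.1 v.1} := by
      ext x
      simp only [Set.mem_singleton_iff]
      constructor
      · rintro ⟨p, hp, rfl⟩
        exact wGraph_len hW p hp
      · rintro rfl
        obtain ⟨p, hp⟩ := (wGraph_reach hW u v).exists_isPath
        exact ⟨p, hp, (wGraph_len hW p hp).symm⟩
    unfold MGTree.dist
    rw [this, csInf_singleton]
  · obtain ⟨a, b, he, hx⟩ := hW.exists_edge x
    by_cases hab : a = b
    · subst hab
      have hxa := btw_self hx
      subst hxa
      obtain ⟨y, hy⟩ := @exists_ne R.X R.nontrivial x
      have : ∃ v ∈ W, v ≠ x := by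
        by_contra hcon
        push Not at hcon
        obtain ⟨u, hu, v, hv, h⟩ := hW.cover y
        rw [hcon u hu, hcon v hv] at h
        exact hy (btw_self h)
      obtain ⟨v, hv, hvx⟩ := this
      obtain ⟨p, hp⟩ := (wGraph_reach hW ⟨x, he.1⟩ ⟨v, hv⟩).exists_isPath
      cases p with
      | nil => exact absurd rfl hvx
      | @cons _ w _ h p => exact ⟨⟨x, he.1⟩, w, h, btw_left _ _⟩
    · exact ⟨⟨a, he.1⟩, ⟨b, he.2.1⟩, ⟨fun e => hab (Subtype.ext_iff.1 e), he⟩, hx⟩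

end mk

end RGTree

namespace RGTree

variable {G : Type u} [Group G] {R : RGTree G}

lemma seg_cover3 {x y w u v : R.X} (h : R.Btw x w y) :
    R.Btw x w u ∨ R.Btw u w v ∨ R.Btw v w y := by
  rcases btw_tripod h u with h | h
  · exact Or.inl h
  · rcases btw_tripod h v with h | h
    · exact Or.inr (Or.inl h)
    · exact Or.inr (Or.inr h)

/-- finiteness on segments between vertices implies finiteness on all segments. -/
lemma fin_of_vert {V W : Set R.X} (hcov : ∀ x : R.X, ∃ u ∈ V, ∃ v ∈ V, R.Btw u x v)
    (hfin : ∀ u ∈ V, ∀ v ∈ V, {w : R.X | w ∈ W ∧ R.Btw u w v}.Finite) (x y : R.X) :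
    {w : R.X | w ∈ W ∧ R.Btw x w y}.Finite := by
  obtain ⟨u, hu, u', hu', h1⟩ := hcov x
  obtain ⟨v, hv, v', hv', h2⟩ := hcov y
  refine (((hfin u hu u' hu').union (hfin u hu v hv)).union (hfin v hv v' hv')).subset ?_
  rintro w ⟨hw, hb⟩
  rcases seg_cover3 (u := u) (v := v) hb with h | h | h
  · exact Or.inl (Or.inl ⟨hw, (btw_trans_left h1 (btw_symm h)).1⟩)
  · exact Or.inl (Or.inr ⟨hw, h⟩)
  · exact Or.inr ⟨hw, (btw_trans_left h2 h).1⟩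

lemma fin_of_edges {V W : Set R.X} (hcov : ∀ x : R.X, ∃ u ∈ V, ∃ v ∈ V, R.Btw u x v)
    (hfin : ∀ x y : R.X, {w : R.X | w ∈ V ∧ R.Btw x w y}.Finite)
    (hE : ∀ a b, R.Edge V a b → {w : R.X | w ∈ W ∧ R.Btw a w b}.Finite) (x y : R.X) :
    {w : R.X | w ∈ W ∧ R.Btw x w y}.Finite := by
  refine fin_of_vert hcov (fun u hu v hv => ?_) x y
  have hf := hfin u v
  have : (⋃ a ∈ {w : R.X | w ∈ V ∧ R.Btw u w v}, ⋃ b ∈ {w : R.X | w ∈ V ∧ R.Btw u w v},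
      {w : R.X | R.Edge V a b ∧ w ∈ W ∧ R.Btw a w b}).Finite := by
    refine hf.biUnion fun a _ => hf.biUnion fun b _ => ?_
    by_cases he : R.Edge V a b
    · exact (hE a b he).subset (fun w hw => hw.2)
    · convert Set.finite_empty (α := R.X)
      ext w; simp [he]
  refine this.subset ?_
  rintro w ⟨hw, hb⟩
  obtain ⟨a, b, he, h1, h2, h3⟩ := consec hfin u v hu hv w hb
  simp only [Set.mem_iUnion]
  exact ⟨a, ⟨he.1, h1⟩, b, ⟨he.2.1, h2⟩, he, hw, h3⟩

/-- Induction over edges. -/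
lemma Simpl.edge_induct {W : Set R.X} (hW : Simpl R W) (P : R.X → R.X → Prop)
    (hedge : ∀ a b, R.Edge W a b → P a b)
    (hsplit : ∀ a b c, a ∈ W → b ∈ W → c ∈ W → R.Btw a b c → P a b → P b c → P a c)
    (u v : R.X) (hu : u ∈ W) (hv : v ∈ W) : P u v := by
  induction hn : (hW.fin u v).toFinset.card using Nat.strong_induction_on generalizing u v with
  | _ n ih =>
    by_cases he : R.Edge W u v
    · exact hedge _ _ he
    · unfold Edge at he
      push Not at he
      obtain ⟨w, hw, hb, hwu, hwv⟩ := he hu hv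
      have r1 := ih (hW.fin u w).toFinset.card (by
          rw [← hn]
          apply Finset.card_lt_card
          rw [Finset.ssubset_iff_of_subset]
          · refine ⟨v, ?_, ?_⟩
            · simpa using ⟨hv, btw_right _ _⟩
            · simp only [Set.Finite.mem_toFinset]
              rintro ⟨_, h''⟩
              exact hwv (btw_antisymm hb h'')
          · intro z hz
            simp only [Set.Finite.mem_toFinset] at hz ⊢
            exact ⟨hz.1, (btw_trans_left hb hz.2).1⟩) u w hu hw rfl
      have r2 := ih (hW.fin w v).toFinset.card (by
          rw [← hn]
          apply Finset.card_lt_card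
          rw [Finset.ssubset_iff_of_subset]
          · refine ⟨u, ?_, ?_⟩
            · simpa using ⟨hu, btw_left _ _⟩
            · simp only [Set.Finite.mem_toFinset]
              rintro ⟨_, h''⟩
              exact hwu (btw_antisymm (btw_symm hb) (btw_symm h''))
          · intro z hz
            simp only [Set.Finite.mem_toFinset] at hz ⊢
            exact ⟨hz.1, (btw_trans_right hb hz.2).1⟩) w v hw hv rfl
      exact hsplit _ _ _ hu hw hv hb r1 r2

end RGTree

namespace MGTree

variable {G : Type u} [Group G] {T : MGTree G}

lemma dist_path {u v : T.V} (p : T.graph.Walk u v) (hp : p.IsPath) : T.dist u v = T.walkLen p := by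
  have : {x : ℝ | ∃ p : T.graph.Walk u v, p.IsPath ∧ x = T.walkLen p} = {T.walkLen p} := by
    ext x
    simp only [Set.mem_singleton_iff]
    constructor
    · rintro ⟨q, hq, rfl⟩
      rw [T.isTree.existsUnique_path u v |>.unique hq hp]
    · rintro rfl
      exact ⟨p, hp, rfl⟩
  rw [MGTree.dist, this, csInf_singleton]

lemma dist_adj {u v : T.V} (h : T.graph.Adj u v) : T.dist u v = T.len u v := by
  rw [dist_path (SimpleGraph.Walk.cons h SimpleGraph.Walk.nil)]
  · simp [walkLen]
  · simp [h.ne]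

lemma dist_concat {w u v : T.V} (p : T.graph.Walk w u) (hp : p.IsPath) (h : T.graph.Adj u v)
    (hv : v ∉ p.support) : T.dist w v = T.dist w u + T.len u v := by
  rw [dist_path (p.concat h) (hp.concat hv h), dist_path p hp]
  simp [walkLen, SimpleGraph.Walk.darts_concat]

lemma dist_dichotomy (w : T.V) {u v : T.V} (h : T.graph.Adj u v) :
    T.dist w v = T.dist w u + T.len u v ∨ T.dist w u = T.dist w v + T.len u v := by
  obtain ⟨p, hp, -⟩ := T.isTree.existsUnique_path w u
  by_cases hv : v ∈ p.support
  · right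
    rw [T.len_symm u v]
    refine dist_concat (p.takeUntil v hv) (hp.takeUntil hv) h.symm ?_
    exact SimpleGraph.Walk.endpoint_notMem_support_takeUntil hp hv h.ne
  · left
    exact dist_concat p hp h hv

end MGTree

namespace RGTree

variable {G : Type u} [Group G] {R : RGTree G} {T : MGTree G} {f : T.V → R.X}

lemma real_dichotomy (hf : IsRealizationMap R T f) (w : T.V) {u v : T.V} (h : T.graph.Adj u v) :
    R.Btw (f w) (f u) (f v) ∨ R.Btw (f w) (f v) (f u) := by
  unfold Btw
  rw [hf.2.1, hf.2.1, hf.2.1, hf.2.1, MGTree.dist_adj h, MGTree.dist_adj h.symm, T.len_symm v u]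
  rcases MGTree.dist_dichotomy w h with h | h
  · left; linarith
  · right; linarith

lemma real_ne (hf : IsRealizationMap R T f) {u v : T.V} (h : T.graph.Adj u v) : f u ≠ f v := by
  rw [← dist_pos, hf.2.1, MGTree.dist_adj h]
  exact T.len_pos _ _ h

lemma real_edge (hf : IsRealizationMap R T f) {u v : T.V} (h : T.graph.Adj u v) :
    R.Edge (Set.range f) (f u) (f v) := by
  refine ⟨⟨u, rfl⟩, ⟨v, rfl⟩, ?_⟩
  rintro _ ⟨w, rfl⟩ hb
  rcases real_dichotomy hf w h with h | h
  · exact Or.inl (btw_antisymm (btw_symm h) (btw_symm hb)).symm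
  · exact Or.inr (btw_antisymm (btw_symm h) hb).symm

lemma real_ep (hf : IsRealizationMap R T f) {u v : T.V} (h : T.graph.Adj u v) (x : R.X) :
    R.Btw (f u) x (f v) ∨ R.Btw x (f u) (f v) ∨ R.Btw x (f v) (f u) := by
  obtain ⟨m, h1, h2, h3⟩ := exists_median (R := R) x (f u) (f v)
  by_cases hx : m = x
  · left; rwa [← hx]
  by_cases ha : m = f u
  · right; left; rw [ha] at h3; exact h3
  by_cases hb : m = f v
  · right; right; rw [hb] at h1; exact h1
  exfalso
  obtain ⟨w, w', hw, hxw⟩ := hf.2.2 x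
  have same : ∀ u, R.Btw x m u → ¬ R.Btw (f w) m u → ¬ R.Btw (f w') m u → False := by
    intro u k1 k2 k3
    have e1 := (btw_tripod k1 (f w)).resolve_right k2
    have e2 := (btw_tripod k1 (f w')).resolve_right k3
    apply hx
    unfold Btw at *
    have t1 := dist_triangle (f w) m (f w')
    have t2 := dist_comm m (f w)
    have t3 := dist_comm x (f w)
    have t4 := dist_comm x m
    rw [← dist_eq_zero]
    have := dist_nonneg (x := x) (y := m)
    linarith
  have dir : ∀ w u v : R.X, R.Btw w u v → R.Btw u m v → m ≠ u → ¬ R.Btw w m u := by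
    intro w u v k1 k2 k3 k4
    have := (btw_trans_right k1 k2).2
    exact k3 (btw_antisymm k4 this)
  have hne := real_ne hf h
  have mixed : ∀ a b : R.X, R.Edge (Set.range f) a b → R.Btw a x b → a ≠ b → R.Btw a (f u) (f v) → R.Btw b (f v) (f u) → False := by
    intro a b he hx' hab k1 k2
    obtain ⟨g1, g2⟩ := btw_glue k1 (btw_symm k2) hne
    have : R.Btw (f u) x (f v) := by
      rcases he.2.2 _ ⟨u, rfl⟩ g1 with e | e
      · rcases he.2.2 _ ⟨v, rfl⟩ g2 with e' | e'
        · exact absurd (e.trans e'.symm) hne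
        · rw [e, e']; exact hx'
      · rcases he.2.2 _ ⟨v, rfl⟩ g2 with e' | e'
        · rw [e, e']; exact btw_symm hx'
        · exact absurd (e.trans e'.symm) hne
    have q1 := h1
    have q3 := h3
    apply hx
    rw [← dist_eq_zero]
    unfold Btw at *
    have t1 := dist_comm x m
    have t2 := dist_comm x (f u)
    have t3 := dist_comm m (f u)
    have := dist_nonneg (x := x) (y := m)
    linarith
  have E := real_edge hf hw
  rcases real_dichotomy hf w h with k1 | k1 <;> rcases real_dichotomy hf w' h with k2 | k2
  · exact same (f u) h1 (dir _ _ _ k1 h2 ha) (dir _ _ _ k2 h2 ha)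
  · exact mixed _ _ E hxw (real_ne hf hw) k1 k2
  · exact mixed _ _ E.symm (btw_symm hxw) (real_ne hf hw).symm k2 k1
  · exact same (f v) h3 (dir _ _ _ k1 (btw_symm h2) hb) (dir _ _ _ k2 (btw_symm h2) hb)

lemma real_branch (hf : IsRealizationMap R T f) (m x y z : R.X) (hxy : R.Btw x m y)
    (hyz : R.Btw y m z) (hxz : R.Btw x m z) (hmx : m ≠ x) (hmy : m ≠ y) (hmz : m ≠ z) :
    m ∈ Set.range f := by
  by_contra hm
  obtain ⟨u, v, huv, hb⟩ := hf.2.2 m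
  have hu : m ≠ f u := fun h => hm ⟨u, h.symm⟩
  have hv : m ≠ f v := fun h => hm ⟨v, h.symm⟩
  have key : ∀ x, m ≠ x → ¬ R.Btw x m (f u) ∨ ¬ R.Btw x m (f v) := by
    intro x hx
    by_contra hc
    push Not at hc
    obtain ⟨c1, c2⟩ := hc
    rcases real_ep hf huv x with h | h | h
    · rcases btw_total hb h with k | k
      · exact hx (btw_antisymm (btw_symm c2) (btw_symm k.2))
      · exact hx (btw_antisymm (btw_symm c1) k.1)
    · exact hu (btw_antisymm c1 (btw_trans_right h hb).2)
    · exact hv (btw_antisymm c2 (btw_trans_right h (btw_symm hb)).2)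
  have P : ∀ x y, R.Btw x m y → ∀ u, ¬ R.Btw x m u → ¬ R.Btw y m u → False :=
    fun x y h u h1 h2 => dir_trans h1 (dir_symm h2) h
  rcases key x hmx with h1 | h1 <;> rcases key y hmy with h2 | h2 <;>
    rcases key z hmz with h3 | h3 <;>
  first
  | exact P _ _ hxy _ h1 h2
  | exact P _ _ hyz _ h2 h3
  | exact P _ _ hxz _ h1 h3

lemma real_support (hf : IsRealizationMap R T f) {u v : T.V} (p : T.graph.Walk u v) (w : R.X)
    (hw : w ∈ Set.range f) (hb : R.Btw (f u) w (f v)) : w ∈ f '' {x | x ∈ p.support} := by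
  induction p with
  | nil => exact ⟨_, by simp, (btw_self hb).symm⟩
  | cons h p ih =>
    rename_i a b c
    rcases btw_tripod hb (f b) with k | k
    · rcases (real_edge hf h).2.2 w hw k with k | k
      · exact ⟨a, by simp, k.symm⟩
      · exact ⟨b, by simp, k.symm⟩
    · obtain ⟨x, hx, rfl⟩ := ih k
      exact ⟨x, by simp at hx ⊢; exact Or.inr hx, rfl⟩

lemma real_simpl (hf : IsRealizationMap R T f) : Simpl R (Set.range f) where
  inv := by rintro g _ ⟨v, rfl⟩; exact ⟨_, hf.1 g v⟩
  branch := real_branch hf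
  cover := fun x => by
    obtain ⟨u, v, h, hb⟩ := hf.2.2 x
    exact ⟨_, ⟨u, rfl⟩, _, ⟨v, rfl⟩, hb⟩
  fin := by
    refine fin_of_vert (V := Set.range f) (fun x => ?_) ?_
    · obtain ⟨u, v, h, hb⟩ := hf.2.2 x
      exact ⟨_, ⟨u, rfl⟩, _, ⟨v, rfl⟩, hb⟩
    · rintro _ ⟨u, rfl⟩ _ ⟨v, rfl⟩
      obtain ⟨p⟩ := T.isTree.1.preconnected u v
      refine ((List.finite_toSet p.support).image f).subset ?_
      rintro w ⟨hw, hb⟩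
      exact real_support hf p w hw hb

lemma real_inj (hf : IsRealizationMap R T f) : Function.Injective f := by
  intro u v huv
  obtain ⟨p, hp, -⟩ := T.isTree.existsUnique_path u v
  have h1 : T.dist u v = 0 := by rw [← hf.2.1, huv, dist_self]
  rw [MGTree.dist_path p hp] at h1
  cases p with
  | nil => rfl
  | cons h q =>
    exfalso
    have : 0 ≤ T.walkLen q := by
      unfold MGTree.walkLen
      apply List.sum_nonneg
      intro x hx
      simp only [List.mem_map] at hx
      obtain ⟨d, _, rfl⟩ := hx
      exact (T.len_pos _ _ d.adj).le
    have h2 := T.len_pos _ _ h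
    simp only [MGTree.walkLen, SimpleGraph.Walk.darts_cons, List.map_cons, List.sum_cons] at h1 this
    linarith

lemma real_noinv (hf : IsRealizationMap R T f) (g : G) (a b : R.X) (he : R.Edge (Set.range f) a b)
    (hab : a ≠ b) (h1 : R.act g a = b) (h2 : R.act g b = a) : False := by
  obtain ⟨m, hm, _, hmW⟩ := edge_mid he hab
  obtain ⟨u, v, huv, hb⟩ := hf.2.2 m
  rcases edge_unique (real_simpl hf).branch he (real_edge hf huv) hmW hm hb with ⟨rfl, rfl⟩ | ⟨rfl, rfl⟩
  · rw [← hf.1] at h1 h2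
    exact T.noInversion g u v huv ⟨real_inj hf h1, real_inj hf h2⟩
  · rw [← hf.1] at h1 h2
    exact T.noInversion g u v huv ⟨real_inj hf h2, real_inj hf h1⟩

end RGTree

namespace RGTree

variable {G : Type u} [Group G] {R : RGTree G}

lemma act_mul (g h : G) (x : R.X) : R.act (g * h) x = R.act g (R.act h x) := by simp

lemma cocpt [Group.FG G] (R : RGTree G) (v : R.X) :
    ∃ S : Set G, S.Finite ∧ ∀ x : R.X, ∃ g : G, ∃ s ∈ S, R.Btw v (R.act g x) (R.act s v) := by
  obtain ⟨S0, hcl, hfin⟩ := Group.fg_iff.1 ‹Group.FG G›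
  refine ⟨insert 1 S0, hfin.insert 1, ?_⟩
  set S := insert 1 S0 with hS
  set Y : Set R.X := {x | ∃ g : G, ∃ s ∈ S, R.Btw v (R.act g x) (R.act s v)} with hY
  have base : ∀ g : G, ∀ s ∈ S, ∀ z, R.Btw (R.act g v) z (R.act g (R.act s v)) → z ∈ Y := by
    intro g s hs z hz
    refine ⟨g⁻¹, s, hs, ?_⟩
    have := btw_act g⁻¹ hz
    rwa [act_inv_act, act_inv_act] at this
  have seg1 : ∀ k : G, ∀ g : G, ∀ z, R.Btw (R.act g v) z (R.act (g * k) v) → z ∈ Y := by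
    intro k
    have hk : k ∈ Subgroup.closure S0 := by rw [hcl]; trivial
    induction hk using Subgroup.closure_induction with
    | mem x hx => intro g z hz; exact base g x (Set.mem_insert_of_mem _ hx) z (by rwa [act_mul] at hz)
    | one => intro g z hz; exact base g 1 (Set.mem_insert _ _) z (by rwa [act_mul] at hz)
    | mul x y _ _ hx hy =>
      intro g z hz
      rcases btw_tripod hz (R.act (g * x) v) with h | h
      · exact hx g z h
      · exact hy (g * x) z (by rwa [mul_assoc])
    | inv x _ hx =>
      intro g z hz
      refine hx (g * x⁻¹) z ?_
      rw [inv_mul_cancel_right]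
      exact btw_symm hz
  have seg : ∀ g h : G, ∀ z, R.Btw (R.act g v) z (R.act h v) → z ∈ Y := by
    intro g h z hz
    refine seg1 (g⁻¹ * h) g z ?_
    rwa [mul_inv_cancel_left]
  have huniv : Y = Set.univ := by
    refine R.minimal Y ⟨v, seg 1 1 v (by simp [Btw])⟩ ?_ ?_
    · rintro h x ⟨g, s, hs, hb⟩
      exact ⟨g * h⁻¹, s, hs, by rwa [act_mul, act_inv_act]⟩
    · rintro x ⟨g, s, hs, hx⟩ y ⟨g', s', hs', hy⟩ z hz
      have hx' := btw_act g⁻¹ hx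
      have hy' := btw_act g'⁻¹ hy
      rw [act_inv_act, ← act_mul] at hx' hy'
      rcases seg_cover3 (R := R) (u := R.act g⁻¹ v) (v := R.act g'⁻¹ v) hz with h | h | h
      · exact seg _ _ _ (btw_trans_left hx' (btw_symm h)).1
      · exact seg _ _ _ h
      · exact seg _ _ _ (btw_trans_left hy' h).1
  intro x
  have : x ∈ Y := by rw [huniv]; trivial
  exact this

lemma cocpt_dist [Group.FG G] (R : RGTree G) (v : R.X) :
    ∃ D : ℝ, ∀ x : R.X, ∃ g : G, dist v (R.act g x) ≤ D := by
  obtain ⟨S, hS, h⟩ := cocpt R v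
  obtain ⟨D, hD⟩ := (hS.image (fun s => dist v (R.act s v))).bddAbove
  refine ⟨D, fun x => ?_⟩
  obtain ⟨g, s, hs, hb⟩ := h x
  refine ⟨g, le_trans ?_ (hD ⟨s, hs, rfl⟩)⟩
  unfold Btw at hb
  have := dist_nonneg (x := R.act g x) (y := R.act s v)
  simp only
  linarith

lemma Simpl.nonempty {W : Set R.X} (hW : Simpl R W) : ∃ v, v ∈ W := by
  obtain ⟨x, _, _⟩ := R.nontrivial
  obtain ⟨u, hu, _⟩ := hW.cover x
  exact ⟨u, hu⟩

lemma Simpl.finite_edges [Group.FG G] {W : Set R.X} (hW : Simpl R W) :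
    ∃ F : Set (R.X × R.X), F.Finite ∧ ∀ a b, R.Edge W a b → a ≠ b →
      ∃ g : G, (R.act g a, R.act g b) ∈ F := by
  obtain ⟨v, hv⟩ := hW.nonempty
  obtain ⟨S, hS, h⟩ := cocpt R v
  have hK : (⋃ s ∈ S, {w : R.X | w ∈ W ∧ R.Btw v w (R.act s v)}).Finite :=
    hS.biUnion fun s _ => hW.fin _ _
  refine ⟨_, hK.prod hK, ?_⟩
  intro a b he hab
  obtain ⟨m, hm, _, hmW⟩ := edge_mid he hab
  obtain ⟨g, s, hs, hb⟩ := h m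
  refine ⟨g, ?_⟩
  obtain ⟨c, d, he', h1, h2, h3⟩ := consec hW.fin v (R.act s v) hv (hW.inv _ _ hv) _ hb
  have hgm : R.act g m ∉ W := fun hh => hmW (by
    have := hW.inv g⁻¹ _ hh
    rwa [act_inv_act] at this)
  simp only [Set.mem_prod, Set.mem_iUnion]
  rcases edge_unique hW.branch (he.act hW.inv g) he' hgm (btw_act g hm) h3 with ⟨e1, e2⟩ | ⟨e1, e2⟩
  · rw [← e1, ← e2]
    exact ⟨⟨s, hs, he'.1, h1⟩, ⟨s, hs, he'.2.1, h2⟩⟩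
  · rw [← e1, ← e2]
    exact ⟨⟨s, hs, he'.2.1, h2⟩, ⟨s, hs, he'.1, h1⟩⟩

open scoped Pointwise in
lemma Simpl.fd [Group.FG G] {W : Set R.X} (hW : Simpl R W) (C : ℝ) :
    ∃ D : Set ℝ, D.Finite ∧ 0 ∈ D ∧ ∀ a ∈ W, ∀ b ∈ W, dist a b ≤ C → dist a b ∈ D := by
  obtain ⟨F, hF, hFe⟩ := hW.finite_edges
  set Λ : Set ℝ := (fun x : R.X × R.X => dist x.1 x.2) '' F \ {0} with hΛ
  have hΛf : Λ.Finite := (hF.image _).subset Set.diff_subset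
  have hpos : ∀ x ∈ Λ, 0 < x := by
    rintro x ⟨⟨y, _, rfl⟩, hx⟩
    exact lt_of_le_of_ne dist_nonneg (fun h => hx h.symm)
  have hε : ∃ ε > 0, ∀ x ∈ Λ, ε ≤ x := by
    rcases Λ.eq_empty_or_nonempty with h | h
    · exact ⟨1, one_pos, by simp [h]⟩
    · obtain ⟨m, hm, hm'⟩ := Set.exists_min_image Λ id hΛf h
      exact ⟨m, hpos m hm, hm'⟩
  obtain ⟨ε, hε, hεΛ⟩ := hε
  have key : ∀ a b, a ∈ W → b ∈ W → ∃ n : ℕ, dist a b ∈ n • Λ ∧ n * ε ≤ dist a b := by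
    intro a b ha hb
    refine hW.edge_induct (fun a b => ∃ n : ℕ, dist a b ∈ n • Λ ∧ n * ε ≤ dist a b) ?_ ?_ a b ha hb
    · intro a b he
      by_cases hab : a = b
      · refine ⟨0, ?_, ?_⟩
        · rw [hab]; simp
        · simp
      · have : dist a b ∈ Λ := by
          obtain ⟨g, hg⟩ := hFe a b he hab
          exact ⟨⟨_, hg, dist_act _ _ _⟩, fun h => hab (dist_eq_zero.1 h)⟩
        exact ⟨1, by simpa using this, by simpa using hεΛ _ this⟩
    · rintro a b c _ _ _ hb ⟨n, h1, h2⟩ ⟨m, h3, h4⟩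
      refine ⟨n + m, ?_, ?_⟩
      · rw [add_nsmul, ← hb]
        exact Set.add_mem_add h1 h3
      · rw [← hb]; push_cast; linarith
  have hfin : ∀ n : ℕ, (n • Λ).Finite := by
    intro n
    induction n with
    | zero => simp
    | succ n ih => rw [succ_nsmul]; exact ih.add hΛf
  obtain ⟨N, hN⟩ := exists_nat_gt (C / ε)
  refine ⟨insert 0 (⋃ n ∈ Set.Iio N, n • Λ), ((Set.finite_Iio N).biUnion fun n _ => hfin n).insert 0, Set.mem_insert _ _, ?_⟩
  intro a ha b hb hC
  obtain ⟨n, h1, h2⟩ := key a b ha hb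
  refine Set.mem_insert_of_mem _ ?_
  simp only [Set.mem_iUnion]
  refine ⟨n, ?_, h1⟩
  have : (n : ℝ) < N := by
    have : (n : ℝ) ≤ C / ε := by rw [le_div_iff₀ hε]; linarith
    linarith
  exact_mod_cast this

lemma Simpl.adjoin {V : Set R.X} (hV : Simpl R V) {K : Set R.X} (hK : K.Finite) :
    Simpl R (V ∪ {x | ∃ g : G, R.act g x ∈ K}) where
  inv := by
    rintro g x (h | ⟨h, hx⟩)
    · exact Or.inl (hV.inv g x h)
    · exact Or.inr ⟨h * g⁻¹, by rwa [act_mul, act_inv_act]⟩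
  branch := fun m x y z h1 h2 h3 h4 h5 h6 => Or.inl (hV.branch m x y z h1 h2 h3 h4 h5 h6)
  cover := fun x => by
    obtain ⟨u, hu, v, hv, h⟩ := hV.cover x
    exact ⟨u, Or.inl hu, v, Or.inl hv, h⟩
  fin := by
    refine fin_of_edges hV.cover hV.fin ?_
    intro a b he
    choose A B hE hAB using hV.exists_edge
    have hfin : (⋃ k ∈ K, ({x | R.Btw a x b ∧ dist a x = dist (A k) k} ∪ {x | R.Btw a x b ∧ dist a x = dist (B k) k})).Finite := by
      refine hK.biUnion fun k _ => ?_
      have : ∀ s : ℝ, {x | R.Btw a x b ∧ dist a x = s}.Finite := by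
        intro s
        apply Set.Subsingleton.finite
        rintro x ⟨hx, hx'⟩ y ⟨hy, hy'⟩
        exact btw_unique hx hy (hx'.trans hy'.symm)
      exact (this _).union (this _)
    refine ((Set.finite_singleton a).union ((Set.finite_singleton b).union hfin)).subset ?_
    rintro w ⟨hw, hb⟩
    by_cases hwV : w ∈ V
    · rcases he.2.2 w hwV hb with h | h
      · exact Or.inl h
      · exact Or.inr (Or.inl h)
    · right; right
      obtain ⟨g, hg⟩ := hw.resolve_left hwV
      have hgw : R.act g w ∉ V := fun hh => hwV (by
        have := hV.inv g⁻¹ _ hh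
        rwa [act_inv_act] at this)
      simp only [Set.mem_iUnion]
      refine ⟨_, hg, ?_⟩
      rcases edge_unique hV.branch (he.act hV.inv g) (hE (R.act g w)) hgw (btw_act g hb) (hAB _) with ⟨e1, e2⟩ | ⟨e1, e2⟩
      · left
        exact ⟨hb, by rw [e1, dist_act]⟩
      · right
        exact ⟨hb, by rw [e2, dist_act]⟩

/-- `f` is isometric on `[a,b]`. -/
def IsoOn {R S : RGTree G} (f : R.X → S.X) (a b : R.X) : Prop :=
  ∀ p q, R.Btw a p b → R.Btw a q b → dist (f p) (f q) = dist p q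

lemma IsoOn.mono {R S : RGTree G} {f : R.X → S.X} {a b c d : R.X} (h : IsoOn f a b)
    (hc : R.Btw a c b) (hd : R.Btw a d b) : IsoOn f c d :=
  fun p q hp hq => h p q (btw_convex hc hd hp) (btw_convex hc hd hq)

lemma IsoOn.symm {R S : RGTree G} {f : R.X → S.X} {a b : R.X} (h : IsoOn f a b) : IsoOn f b a :=
  fun p q hp hq => h p q (btw_symm hp) (btw_symm hq)

lemma IsoOn.act {R S : RGTree G} {f : R.X → S.X} (hf : ∀ (g : G) (x : R.X), f (R.act g x) = S.act g (f x)) {a b : R.X} (h : IsoOn f a b) (g : G) :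
    IsoOn f (R.act g a) (R.act g b) := by
  intro p q hp hq
  have hp' := btw_act g⁻¹ hp
  have hq' := btw_act g⁻¹ hq
  rw [act_inv_act, act_inv_act] at hp' hq'
  have := h _ _ hp' hq'
  rwa [hf, hf, dist_act, dist_act] at this

section morph

variable {S : RGTree G} (φ : RMorphism R S)

lemma chain (x y : R.X) : ∃ K : Set R.X, K.Finite ∧ x ∈ K ∧ y ∈ K ∧
    Relation.ReflTransGen (fun a b => a ∈ K ∧ b ∈ K ∧ IsoOn φ.f a b) x y := by
  obtain ⟨n, c, h0, h1, h2, h3⟩ := φ.piecewise x y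
  refine ⟨Set.range c, Set.finite_range c, ⟨0, h0⟩, ⟨_, h1⟩, ?_⟩
  have key : ∀ m : ℕ, ∀ hm : m < n + 1, Relation.ReflTransGen (fun a b => a ∈ Set.range c ∧ b ∈ Set.range c ∧ IsoOn φ.f a b) x (c ⟨m, hm⟩) := by
    intro m
    induction m with
    | zero => intro hm; rw [← h0]; exact Relation.ReflTransGen.refl
    | succ m ih =>
      intro hm
      refine (ih (by omega)).tail ⟨⟨_, rfl⟩, ⟨_, rfl⟩, ?_⟩
      exact h3 ⟨m, by omega⟩
  rw [← h1]
  exact key n (by omega)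

lemma chain' (x y : R.X) : Relation.ReflTransGen (fun a b => IsoOn φ.f a b) x y := by
  obtain ⟨K, _, _, _, h⟩ := chain φ x y
  exact h.lift id fun a b h => h.2.2

lemma chain_cover {K : Set R.X} {x y : R.X} (hx : x ∈ K)
    (h : Relation.ReflTransGen (fun a b => a ∈ K ∧ b ∈ K ∧ IsoOn φ.f a b) x y) (z : R.X)
    (hz : R.Btw x z y) : ∃ a b, a ∈ K ∧ b ∈ K ∧ IsoOn φ.f a b ∧ R.Btw a z b := by
  induction h with
  | refl =>
    refine ⟨x, x, hx, hx, ?_, hz⟩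
    intro p q hp hq
    rw [btw_self hp, btw_self hq]; simp
  | tail h1 h2 ih =>
    rename_i b c
    rcases btw_tripod hz b with h | h
    · exact ih h
    · exact ⟨b, c, h2.1, h2.2.1, h2.2.2, h⟩

lemma morph_lip (x y : R.X) : dist (φ.f x) (φ.f y) ≤ dist x y := by
  have key : ∀ z, R.Btw x z y → dist (φ.f x) (φ.f z) ≤ dist x z := by
    induction chain' φ x y with
    | refl => intro z hz; rw [btw_self hz]; simp
    | tail h1 h2 ih =>
      rename_i b c
      intro z hz
      rcases btw_tripod hz b with h | h
      · exact ih z h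
      · obtain ⟨m, m1, m2, m3⟩ := exists_median (R := R) x b c
        rcases btw_total hz m3 with k | k
        · exact ih z (btw_trans_left m1 k.1).1
        · have e1 := ih m m1
          have e2 := h2 m z m2 h
          have := dist_triangle (φ.f x) (φ.f m) (φ.f z)
          have k1 := k.1
          unfold Btw at k1
          linarith
  exact key y (btw_right _ _)

end morph

end RGTree

namespace RGTree

variable {G : Type u} [Group G]

lemma exists_equivariant {T₀ T : MGTree G} (hsame : SameDef T₀.toGTree T.toGTree) :
    ∃ h : T.V → T₀.V, ∀ (g : G) (v : T.V), h (T.act g v) = T₀.act g (h v) := by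
  have hw : ∀ v : T.V, ∃ w : T₀.V, ∀ g : G, T.act g v = v → T₀.act g w = w := by
    intro v
    obtain ⟨w, hw⟩ := (hsame (T.stab v)).2 ⟨v, fun h hh => hh⟩
    exact ⟨w, fun g hg => hw g hg⟩
  choose w hw using hw
  let s : Setoid T.V :=
    { r := fun u v => ∃ g : G, T.act g u = v
      iseqv := ⟨fun u => ⟨1, by simp⟩, fun {u v} ⟨g, h⟩ => ⟨g⁻¹, by rw [← h]; simp⟩,
        fun {u v x} ⟨g, h⟩ ⟨g', h'⟩ => ⟨g' * g, by rw [← h', ← h]; simp⟩⟩ }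
  have hrep : ∀ v : T.V, ∃ g : G, T.act g (Quotient.out (Quotient.mk s v)) = v :=
    fun v => Quotient.exact (Quotient.out_eq (Quotient.mk s v))
  choose γ hγ using hrep
  refine ⟨fun v => T₀.act (γ v) (w (Quotient.out (Quotient.mk s v))), ?_⟩
  intro g v
  have hq : Quotient.mk s (T.act g v) = Quotient.mk s v :=
    (Quotient.sound (s := s) ⟨g, rfl⟩ : Quotient.mk s v = _).symm
  have h1 := hγ (T.act g v)
  have h2 := hγ v
  simp only
  rw [hq] at h1 ⊢
  set r := Quotient.out (Quotient.mk s v)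
  have h3 : T.act ((g * γ v)⁻¹ * γ (T.act g v)) r = r := by
    rw [map_mul, Equiv.Perm.mul_apply, h1, map_inv, Equiv.Perm.inv_eq_iff_eq, map_mul,
      Equiv.Perm.mul_apply, h2]
  have h4 := hw _ _ h3
  rw [map_mul, Equiv.Perm.mul_apply, map_inv, Equiv.Perm.inv_eq_iff_eq, map_mul,
      Equiv.Perm.mul_apply] at h4
  exact h4

lemma bound_C [Group.FG G] {T₀ T : MGTree G} (hsame : SameDef T₀.toGTree T.toGTree)
    {R₀ R : RGTree G} {f₀ : T₀.V → R₀.X} (hf₀ : IsRealizationMap R₀ T₀ f₀) {f : T.V → R.X}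
    (hf : IsRealizationMap R T f) (φ : RMorphism R₀ R) :
    ∃ C : ℝ, ∀ x y : R₀.X, φ.f x = φ.f y → dist x y ≤ C := by
  obtain ⟨h, hh⟩ := exists_equivariant hsame
  have hV := real_simpl hf
  obtain ⟨F, hF, hFe⟩ := hV.finite_edges
  -- equivariant map on vertices
  obtain ⟨k, hk⟩ : ∃ k : R.X → R₀.X, ∀ (g : G), ∀ v ∈ Set.range f, k (R.act g v) = R₀.act g (k v) := by
    refine ⟨fun x => if hx : ∃ v, f v = x then f₀ (h hx.choose) else f₀ T₀.nonempty.some, ?_⟩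
    have e : ∀ v, (fun x => if hx : ∃ v, f v = x then f₀ (h hx.choose) else f₀ T₀.nonempty.some) (f v) = f₀ (h v) := by
      intro v
      have hx : ∃ v', f v' = f v := ⟨v, rfl⟩
      simp only [dif_pos hx]
      rw [real_inj hf hx.choose_spec]
    rintro g _ ⟨v, rfl⟩
    rw [← hf.1, e, e, hh, hf₀.1]
  obtain ⟨L, hL⟩ := (hF.image (fun x : R.X × R.X => dist (k x.1) (k x.2) / dist x.1 x.2)).bddAbove
  have lip : ∀ a b, a ∈ Set.range f → b ∈ Set.range f → dist (k a) (k b) ≤ L * dist a b := by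
    intro a b ha hb
    refine hV.edge_induct (fun a b => dist (k a) (k b) ≤ L * dist a b) ?_ ?_ a b ha hb
    · intro a b he
      by_cases hab : a = b
      · simp [hab]
      · obtain ⟨g, hg⟩ := hFe a b he hab
        have := hL ⟨_, hg, rfl⟩
        simp only [hk g a he.1, hk g b he.2.1, dist_act] at this
        rwa [div_le_iff₀ (dist_pos.2 hab)] at this
    · intro a b c _ _ _ hb h1 h2
      have := dist_triangle (k a) (k b) (k c)
      rw [← hb, mul_add]; linarith
  -- nearby vertex
  obtain ⟨B, hB⟩ := (hF.image (fun x : R.X × R.X => dist x.1 x.2)).bddAbove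
  have near : ∀ x : R.X, ∃ v ∈ Set.range f, dist x v ≤ max B 0 := by
    intro x
    obtain ⟨a, b, he, hb⟩ := hV.exists_edge x
    refine ⟨a, he.1, ?_⟩
    by_cases hab : a = b
    · rw [← hab] at hb
      rw [btw_self hb]; simp
    · obtain ⟨g, hg⟩ := hFe a b he hab
      have := hB ⟨_, hg, rfl⟩
      simp only [dist_act] at this
      unfold Btw at hb
      have := dist_nonneg (x := x) (y := b)
      have := le_max_left B 0
      rw [dist_comm]
      linarith
  choose v hv hvd using near
  obtain ⟨x₀, _, _⟩ := R₀.nontrivial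
  obtain ⟨D, hD⟩ := cocpt_dist R₀ x₀
  set B' := max B 0
  set v₁ := v (φ.f x₀)
  have main : ∀ x, dist (k (v (φ.f x))) x ≤ max L 0 * (2 * B' + D) + (dist (k v₁) x₀ + D) := by
    intro x
    obtain ⟨g, hg⟩ := hD x
    have e1 : dist (k (v (φ.f x))) (R₀.act g⁻¹ (k v₁)) ≤ max L 0 * (2 * B' + D) := by
      rw [← hk g⁻¹ _ (hv _)]
      refine (lip _ _ (hv _) (hV.inv _ _ (hv _))).trans ?_
      have a1 := hvd (φ.f x)
      have a2 := hvd (φ.f x₀)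
      have a3 : dist (R.act g⁻¹ (φ.f x₀)) (φ.f x) ≤ D := by
        rw [← φ.equivariant]
        refine (morph_lip φ _ _).trans ?_
        rw [← dist_act g, act_act_inv]; exact hg
      have a4 : dist (R.act g⁻¹ (φ.f x₀)) (R.act g⁻¹ v₁) ≤ B' := by rw [dist_act]; exact a2
      have t1 := dist_triangle (v (φ.f x)) (φ.f x) (R.act g⁻¹ v₁)
      have t2 := dist_triangle (φ.f x) (R.act g⁻¹ (φ.f x₀)) (R.act g⁻¹ v₁)
      rw [dist_comm] at a1
      rw [dist_comm] at a3
      have : dist (v (φ.f x)) (R.act g⁻¹ v₁) ≤ 2 * B' + D := by linarith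
      calc _ ≤ max L 0 * dist (v (φ.f x)) (R.act g⁻¹ v₁) :=
            mul_le_mul_of_nonneg_right (le_max_left _ _) dist_nonneg
        _ ≤ _ := mul_le_mul_of_nonneg_left this (le_max_right _ _)
    have e2 : dist (R₀.act g⁻¹ (k v₁)) x ≤ dist (k v₁) x₀ + D := by
      rw [← dist_act g, act_act_inv]
      exact (dist_triangle _ x₀ _).trans (by linarith)
    exact (dist_triangle _ _ _).trans (add_le_add e1 e2)
  refine ⟨2 * (max L 0 * (2 * B' + D) + (dist (k v₁) x₀ + D)), ?_⟩
  intro x y hxy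
  have m1 := main x
  have m2 := main y
  rw [← hxy] at m2
  rw [dist_comm] at m1
  have := dist_triangle x (k (v (φ.f x))) y
  linarith

end RGTree

namespace RGTree

variable {G : Type u} [Group G] {R₀ R : RGTree G}

lemma iso_inj {R S : RGTree G} {f : R.X → S.X} {a b : R.X} (h : IsoOn f a b) {x y : R.X}
    (hx : R.Btw a x b) (hy : R.Btw a y b) (he : f x = f y) : x = y := by
  have := h x y hx hy
  rw [he, dist_self] at this
  exact dist_eq_zero.1 this.symm

/-- lifting an edge through an isometric piece. -/
lemma lift_edge {R S : RGTree G} {f : R.X → S.X} {W : Set S.X}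
    (hfin : ∀ x y : S.X, {w : S.X | w ∈ W ∧ S.Btw x w y}.Finite) {a b : R.X} (h : IsoOn f a b)
    (ha : f a ∈ W) (hb : f b ∈ W) {z : R.X} (hz : R.Btw a z b) :
    ∃ x y, R.Btw a x b ∧ R.Btw a y b ∧ R.Btw x z y ∧ R.Edge (f ⁻¹' W) x y ∧
      S.Edge W (f x) (f y) := by
  have hz' := (iso_btw f h (btw_left _ _) hz (btw_right _ _)).2 hz
  obtain ⟨A, B, he, h1, h2, h3⟩ := consec hfin _ _ ha hb _ hz'
  obtain ⟨x, hx, rfl⟩ := iso_lift f h h1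
  obtain ⟨y, hy, rfl⟩ := iso_lift f h h2
  refine ⟨x, y, hx, hy, (iso_btw f h hx hz hy).1 h3, ⟨he.1, he.2.1, ?_⟩, he⟩
  intro w hw hwb
  have hwab := btw_convex hx hy hwb
  have := he.2.2 (f w) hw ((iso_btw f h hx hwab hy).2 hwb)
  rcases this with e | e
  · exact Or.inl (iso_inj h hwab hx e)
  · exact Or.inr (iso_inj h hwab hy e)

/-- The combinatorial setup. -/
structure Setup (φ : RMorphism R₀ R) (V : Set R.X) (C : ℝ) (D : Set ℝ) : Prop where
  simpl : Simpl R V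
  noinv : ∃ U, U ⊆ V ∧ Simpl R U ∧ ∀ (g : G) (a b : R.X), R.Edge U a b → a ≠ b → R.act g a = b →
    R.act g b = a → False
  br : ∀ m x y z : R₀.X, R₀.Btw x m y → R₀.Btw y m z → R₀.Btw x m z → m ≠ x → m ≠ y → m ≠ z →
      φ.f m ∈ V
  cov : ∀ x : R₀.X, ∃ a b, R₀.Edge (φ.f ⁻¹' V) a b ∧ IsoOn φ.f a b ∧ R.Edge V (φ.f a) (φ.f b) ∧
    R₀.Btw a x b
  Dfin : D.Finite
  Dzero : 0 ∈ D
  Ddist : ∀ a ∈ V, ∀ b ∈ V, dist a b ≤ C → dist a b ∈ D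
  Dedge : ∀ a b, R.Edge V a b → dist a b ∈ D
  bound : ∀ x y : R₀.X, φ.f x = φ.f y → dist x y ≤ C

lemma exists_setup [Group.FG G] {T₀ T : MGTree G} (hsame : SameDef T₀.toGTree T.toGTree)
    (h₀ : RealizationOf R₀ T₀) (h : RealizationOf R T) (φ : RMorphism R₀ R) :
    ∃ V C D, Setup φ V C D := by
  obtain ⟨f₀, hf₀⟩ := h₀
  obtain ⟨f, hf⟩ := h
  have hU := real_simpl hf
  have hU₀ := real_simpl hf₀
  obtain ⟨F, hF, hFe⟩ := hU₀.finite_edges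
  choose K hK hK1 hK2 hK3 using chain φ
  set K' : Set R₀.X := ⋃ e ∈ F, K e.1 e.2 with hK'
  have hK'f : K'.Finite := hF.biUnion fun e _ => hK _ _
  have hV := hU.adjoin (hK'f.image φ.f)
  set V := Set.range f ∪ {x | ∃ g : G, R.act g x ∈ φ.f '' K'} with hVdef
  have memV : ∀ (g : G) x, R₀.act g x ∈ K' → φ.f x ∈ V := by
    intro g x hx
    exact Or.inr ⟨g, _, hx, φ.equivariant g x⟩
  obtain ⟨C₁, hC₁⟩ := bound_C hsame hf₀ hf φ
  obtain ⟨F', hF', hFe'⟩ := hV.finite_edges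
  obtain ⟨B, hB⟩ := (hF'.image (fun x : R.X × R.X => dist x.1 x.2)).bddAbove
  obtain ⟨D, hD, hD0, hDd⟩ := hV.fd (max C₁ B)
  refine ⟨V, max C₁ B, D, hV, ⟨Set.range f, Set.subset_union_left, hU, real_noinv hf⟩, ?_, ?_, hD, hD0, hDd, ?_, fun x y hxy => (hC₁ x y hxy).trans (le_max_left _ _)⟩
  · intro m x y z h1 h2 h3 h4 h5 h6
    obtain ⟨v, rfl⟩ := hU₀.branch m x y z h1 h2 h3 h4 h5 h6
    obtain ⟨u, w, huw, hb⟩ := hf₀.2.2 (f₀ v)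
    obtain ⟨g, hg⟩ := hFe _ _ (real_edge hf₀ huw) (real_ne hf₀ huw)
    refine memV g _ ?_
    simp only [hK', Set.mem_iUnion]
    refine ⟨_, hg, ?_⟩
    rcases (real_edge hf₀ huw).2.2 _ ⟨v, rfl⟩ hb with e | e
    · rw [e]; exact hK1 _ _
    · rw [e]; exact hK2 _ _
  · intro x
    obtain ⟨u, w, huw, hb⟩ := hf₀.2.2 x
    obtain ⟨g, hg⟩ := hFe _ _ (real_edge hf₀ huw) (real_ne hf₀ huw)
    obtain ⟨a, b, ha, hb', hiso, hz⟩ := chain_cover φ (hK1 _ _) (hK3 _ _) _ (btw_act g hb)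
    have hiso' := hiso.act φ.equivariant g⁻¹
    have hz' := btw_act g⁻¹ hz
    rw [act_inv_act] at hz'
    have key : ∀ a, a ∈ K (R₀.act g (f₀ u)) (R₀.act g (f₀ w)) → φ.f (R₀.act g⁻¹ a) ∈ V := by
      intro a ha
      refine memV g _ ?_
      rw [act_act_inv]
      simp only [hK', Set.mem_iUnion]
      exact ⟨_, hg, ha⟩
    obtain ⟨c, d, h1, h2, h3, h4, h5⟩ := lift_edge hV.fin hiso' (key a ha) (key b hb') hz'
    exact ⟨c, d, h4, hiso'.mono h1 h2, h5, h3⟩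
  · intro a b he
    by_cases hab : a = b
    · rw [hab, dist_self]; exact hD0
    · refine hDd a he.1 b he.2.1 ?_
      obtain ⟨g, hg⟩ := hFe' a b he hab
      have := hB ⟨_, hg, rfl⟩
      simp only [dist_act] at this
      exact this.trans (le_max_right _ _)

section setup

variable {φ : RMorphism R₀ R} {V : Set R.X} {C : ℝ} {D : Set ℝ}

lemma Setup.edge_iso (S : Setup φ V C D) {a b : R₀.X} (he : R₀.Edge (φ.f ⁻¹' V) a b) :
    IsoOn φ.f a b ∧ R.Edge V (φ.f a) (φ.f b) := by
  by_cases hab : a = b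
  · subst hab
    refine ⟨?_, he.1, he.1, fun w _ hb => Or.inl (btw_self hb)⟩
    intro p q hp hq
    rw [btw_self hp, btw_self hq]; simp
  · obtain ⟨m, hm, _, hmW⟩ := edge_mid he hab
    obtain ⟨c, d, h1, h2, h3, h4⟩ := S.cov m
    rcases edge_unique S.br he h1 hmW hm h4 with ⟨rfl, rfl⟩ | ⟨rfl, rfl⟩
    · exact ⟨h2, h3⟩
    · exact ⟨h2.symm, h3.symm⟩

/-- Skora's relation -/
def Sim (φ : RMorphism R₀ R) (t : ℝ) (x y : R₀.X) : Prop :=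
  φ.f x = φ.f y ∧ ∀ z : R₀.X, R₀.Btw x z y → dist (φ.f z) (φ.f x) ≤ t

lemma Setup.sim_of_vert (S : Setup φ V C D) {t : ℝ} (ht : 0 ≤ t) {x y : R₀.X}
    (hxy : φ.f x = φ.f y) (h : ∀ z, φ.f z ∈ V → R₀.Btw x z y → dist (φ.f z) (φ.f x) ≤ t) :
    Sim φ t x y := by
  refine ⟨hxy, fun z hz => ?_⟩
  obtain ⟨a, b, he, hiso, he', hb⟩ := S.cov z
  have side : ∀ x, ∃ u, R₀.Btw x u z ∧ R₀.Btw a u b ∧ (u = x ∨ φ.f u ∈ V) := by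
    intro x
    rcases edge_prop S.br he hb x with k | k | k
    · exact ⟨x, btw_left _ _, k, Or.inl rfl⟩
    · exact ⟨a, k, btw_left _ _, Or.inr he.1⟩
    · exact ⟨b, k, btw_right _ _, Or.inr he.2.1⟩
  obtain ⟨u, u1, u2, u3⟩ := side x
  obtain ⟨v, v1, v2, v3⟩ := side y
  have k1 := btw_trans_left hz u1
  have k2 := btw_trans_right hz (btw_symm v1)
  have k3 := (btw_trans_right k1.2 (btw_symm v1)).2
  have k4 := (iso_btw φ.f hiso u2 hb v2).2 k3
  refine dist_le_of_btw k4 _ _ ?_ ?_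
  · rcases u3 with rfl | u3
    · simpa using ht
    · exact h u u3 k1.1
  · rcases v3 with rfl | v3
    · rw [hxy]; simpa using ht
    · exact h v v3 k2.1

lemma Setup.sim_vert (S : Setup φ V C D) {t t' : ℝ} (ht : 0 ≤ t') (htC : t ≤ C)
    (htt : ∀ δ ∈ D, δ ≤ t → δ ≤ t') {x y : R₀.X} (hx : φ.f x ∈ V) (h : Sim φ t x y) :
    Sim φ t' x y := by
  refine S.sim_of_vert ht h.1 fun z hz hb => ?_
  have := h.2 z hb
  exact htt _ (S.Ddist _ hz _ hx (this.trans htC)) this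

lemma Setup.sim_edge (S : Setup φ V C D) {t t' : ℝ} (ht : 0 ≤ t') (htC : t ≤ C)
    {a b c d : R₀.X} (hab : R₀.Edge (φ.f ⁻¹' V) a b) (hcd : R₀.Edge (φ.f ⁻¹' V) c d)
    (hac : φ.f a = φ.f c) (hbd : φ.f b = φ.f d) {x x' y y' : R₀.X}
    (hx : R₀.Btw a x b) (hx' : R₀.Btw a x' b) (hy : R₀.Btw c y d) (hy' : R₀.Btw c y' d)
    (hs : dist a x' = dist c y')
    (hxa : φ.f x ∉ V) (hxa' : φ.f x' ∉ V)
    (h1 : ∀ δ ∈ D, dist a x ≤ t - δ → dist a x' ≤ t' - δ)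
    (h2 : ∀ δ ∈ D, dist x b ≤ t - δ → dist x' b ≤ t' - δ) (h : Sim φ t x y) :
    Sim φ t' x' y' := by
  obtain ⟨iab, eab⟩ := S.edge_iso hab
  obtain ⟨icd, ecd⟩ := S.edge_iso hcd
  have bx := (iso_btw φ.f iab (btw_left _ _) hx (btw_right _ _)).2 hx
  have bx' := (iso_btw φ.f iab (btw_left _ _) hx' (btw_right _ _)).2 hx'
  have by' := (iso_btw φ.f icd (btw_left _ _) hy' (btw_right _ _)).2 hy'
  have exy' : φ.f x' = φ.f y' := by
    rw [← hac, ← hbd] at by'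
    refine btw_unique bx' by' ?_
    rw [iab a x' (btw_left _ _) hx', hac, icd c y' (btw_left _ _) hy', hs]
  -- no vertices between interior points of an edge
  have noV : ∀ {a b x x' z : R₀.X}, R₀.Edge (φ.f ⁻¹' V) a b → R₀.Btw a x b → R₀.Btw a x' b →
      φ.f x ∉ V → φ.f x' ∉ V → φ.f z ∈ V → R₀.Btw x' z x → False := by
    intro a b x x' z he hx hx' n n' hz hb
    have hne : ∀ w, φ.f w ∉ V → z ≠ w := fun w hw e => hw (e ▸ hz)
    have hz' := btw_convex hx' hx hb
    have fin : ∀ u, R₀.Btw u x x' ∨ R₀.Btw u x' x → z = u → False := by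
      rintro u (k | k) rfl
      · exact hne x n (btw_antisymm (btw_symm k) hb).symm
      · exact hne x' n' (btw_antisymm (btw_symm k) (btw_symm hb)).symm
    rcases he.2.2 z hz hz' with e | e
    · exact fin a ((btw_total hx hx').imp And.left And.left) e
    · exact fin b ((btw_total hx hx').symm.imp (fun k => btw_symm k.2) (fun k => btw_symm k.2)) e
  refine S.sim_of_vert ht exy' fun z hz hb => ?_
  have hzxy : R₀.Btw x z y := by
    rcases seg_cover3 (R := R₀) (u := x) (v := y) hb with k | k | k
    · exact (noV hab hx hx' hxa hxa' hz k).elim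
    · exact k
    · refine (noV hcd hy' hy (exy' ▸ hxa') (h.1 ▸ hxa) hz k).elim
  have hd := h.2 z hzxy
  rcases edge_prop_vert S.simpl.branch eab bx hz with k | k
  · have e := iab a x (btw_left _ _) hx
    have e' := iab a x' (btw_left _ _) hx'
    have := h1 (dist (φ.f z) (φ.f a)) (S.Ddist _ hz _ hab.1 (by
      unfold Btw at k; have := dist_nonneg (x := φ.f a) (y := φ.f x); linarith)) (by unfold Btw at k; linarith)
    have := dist_triangle (φ.f z) (φ.f a) (φ.f x')
    linarith
  · have e := iab x b hx (btw_right _ _)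
    have e' := iab x' b hx' (btw_right _ _)
    rw [dist_comm] at e e'
    have := h2 (dist (φ.f z) (φ.f b)) (S.Ddist _ hz _ hab.2.1 (by
      unfold Btw at k; have := dist_nonneg (x := φ.f b) (y := φ.f x); linarith)) (by unfold Btw at k; linarith)
    have := dist_triangle (φ.f z) (φ.f b) (φ.f x')
    linarith

end setup

end RGTree

namespace RGTree

variable {G : Type u} [Group G] {R₀ R : RGTree G}

/-- Labels of points on edges. -/
abbrev Lbl (D : Set ℝ) := Bool × Option D

/-- base value of a label -/
noncomputable def sv {D : Set ℝ} (t : ℝ) : Option D → ℝ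
  | none => 0
  | some δ => t - δ.1

/-- position of a label on an edge of length `l` at time `t`. -/
noncomputable def al {D : Set ℝ} (i : Lbl D) (l t : ℝ) : ℝ :=
  match i.1 with
  | true => sv t i.2
  | false => l - sv t i.2

/-- opposite label -/
def flip {D : Set ℝ} (i : Lbl D) : Lbl D := (!i.1, i.2)

lemma al_flip {D : Set ℝ} (i : Lbl D) (l t : ℝ) : al (flip i) l t = l - al i l t := by
  obtain ⟨b, o⟩ := i
  cases b <;> simp [flip, al]

/-- The labelled points in the target tree. -/
def WT (V : Set R.X) (D : Set ℝ) (t : ℝ) : Set R.X :=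
  {w | ∃ A B, R.Edge V A B ∧ R.Btw A w B ∧ ∃ i : Lbl D, dist A w = al i (dist A B) t}

section setup

variable {φ : RMorphism R₀ R} {V : Set R.X} {C : ℝ} {D : Set ℝ}

lemma sub_WT {t : ℝ} : V ⊆ WT V D t := by
  intro v hv
  exact ⟨v, v, ⟨hv, hv, fun w _ hb => Or.inl (btw_self hb)⟩, btw_left _ _, (true, none), by simp [al, sv]⟩

lemma lab_of_mem (hV : Simpl R V) {t : ℝ} {w A B : R.X} (hw : w ∈ WT V D t) (he : R.Edge V A B)
    (hb : R.Btw A w B) : ∃ i : Lbl D, dist A w = al i (dist A B) t := by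
  by_cases hwV : w ∈ V
  · rcases he.2.2 w hwV hb with rfl | rfl
    · exact ⟨(true, none), by simp [al, sv]⟩
    · exact ⟨(false, none), by simp [al, sv]⟩
  · obtain ⟨A', B', he', hb', i, hi⟩ := hw
    rcases edge_unique hV.branch he he' hwV hb hb' with ⟨rfl, rfl⟩ | ⟨rfl, rfl⟩
    · exact ⟨i, hi⟩
    · refine ⟨flip i, ?_⟩
      have c1 := dist_comm B' A'
      have c2 := dist_comm A' w
      rw [al_flip, c1, ← hi]
      unfold Btw at hb
      linarith

lemma WT_inv (hV : Simpl R V) {t : ℝ} (g : G) (x : R.X) (hx : x ∈ WT V D t) :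
    R.act g x ∈ WT V D t := by
  obtain ⟨A, B, he, hb, i, hi⟩ := hx
  exact ⟨_, _, he.act hV.inv g, btw_act g hb, i, by rw [dist_act, dist_act, hi]⟩

lemma WT_fin (S : Setup φ V C D) {t : ℝ} (x y : R.X) :
    {w : R.X | w ∈ WT V D t ∧ R.Btw x w y}.Finite := by
  have := S.Dfin.to_subtype
  refine fin_of_edges S.simpl.cover S.simpl.fin ?_ x y
  intro a b he
  have hfin : (⋃ i : Lbl D, {x | R.Btw a x b ∧ dist a x = al i (dist a b) t}).Finite := by
    refine Set.finite_iUnion fun i => ?_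
    apply Set.Subsingleton.finite
    rintro x ⟨hx, hx'⟩ y ⟨hy, hy'⟩
    exact btw_unique hx hy (hx'.trans hy'.symm)
  refine hfin.subset ?_
  rintro w ⟨hw, hb⟩
  obtain ⟨i, hi⟩ := lab_of_mem S.simpl hw he hb
  exact Set.mem_iUnion.2 ⟨i, hb, hi⟩

/-- Skora data -/
structure Sk (φ : RMorphism R₀ R) (t : ℝ) (M : RGTree G) (p : R₀.X → M.X) (q : M.X → R.X) : Prop where
  surj : Function.Surjective p
  pact : ∀ (g : G) (x : R₀.X), p (R₀.act g x) = M.act g (p x)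
  qact : ∀ (g : G) (m : M.X), q (M.act g m) = R.act g (q m)
  qp : ∀ x, q (p x) = φ.f x
  plip : ∀ x y, dist (p x) (p y) ≤ dist x y
  qlip : ∀ m m', dist (q m) (q m') ≤ dist m m'
  sim : ∀ x y, p x = p y ↔ Sim φ t x y

variable {t : ℝ} {M : RGTree G} {p : R₀.X → M.X} {q : M.X → R.X}

lemma Sk.piso (K : Sk φ t M p q) {a b : R₀.X} (h : IsoOn φ.f a b) : IsoOn p a b := by
  intro x y hx hy
  have h1 := h x y hx hy
  have h2 := K.qlip (p x) (p y)
  rw [K.qp, K.qp] at h2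
  have h3 := K.plip x y
  linarith

lemma Sk.qiso (K : Sk φ t M p q) {a b : R₀.X} (h : IsoOn φ.f a b) : IsoOn q (p a) (p b) := by
  intro x y hx hy
  obtain ⟨x, hx', rfl⟩ := iso_lift p (K.piso h) hx
  obtain ⟨y, hy', rfl⟩ := iso_lift p (K.piso h) hy
  rw [K.qp, K.qp, h x y hx' hy', K.piso h x y hx' hy']

lemma Sk.fin (S : Setup φ V C D) (K : Sk φ t M p q) (x y : M.X) :
    {w : M.X | w ∈ q ⁻¹' (WT V D t) ∧ M.Btw x w y}.Finite := by
  obtain ⟨x, rfl⟩ := K.surj x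
  obtain ⟨y, rfl⟩ := K.surj y
  induction chain' φ x y with
  | refl => exact (Set.finite_singleton (p x)).subset fun w hw => btw_self hw.2
  | tail h1 h2 ih =>
    rename_i b c
    have hp : {w : M.X | w ∈ q ⁻¹' (WT V D t) ∧ M.Btw (p b) w (p c)}.Finite := by
      refine Set.Finite.of_finite_image (f := q) ((WT_fin S (t := t) (φ.f b) (φ.f c)).subset ?_) ?_
      · rintro _ ⟨w, ⟨hw, hb⟩, rfl⟩
        refine ⟨hw, ?_⟩
        rw [← K.qp, ← K.qp]
        exact (iso_btw q (K.qiso h2) (btw_left _ _) hb (btw_right _ _)).2 hb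
      · rintro w ⟨_, hw⟩ w' ⟨_, hw'⟩ e
        exact iso_inj (K.qiso h2) hw hw' e
    refine (ih.union hp).subset ?_
    rintro w ⟨hw, hb⟩
    exact (btw_tripod hb (p b)).imp (fun k => ⟨hw, k⟩) (fun k => ⟨hw, k⟩)

lemma Sk.cover (S : Setup φ V C D) (K : Sk φ t M p q) (x : M.X) :
    ∃ u ∈ q ⁻¹' (WT V D t), ∃ v ∈ q ⁻¹' (WT V D t), M.Btw u x v := by
  obtain ⟨x, rfl⟩ := K.surj x
  obtain ⟨a, b, he, hiso, he', hb⟩ := S.cov x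
  refine ⟨p a, ?_, p b, ?_, (iso_btw p (K.piso hiso) (btw_left _ _) hb (btw_right _ _)).2 hb⟩
  · show q (p a) ∈ WT V D t
    rw [K.qp]; exact sub_WT he.1
  · show q (p b) ∈ WT V D t
    rw [K.qp]; exact sub_WT he.2.1

/-- Given two points with the same image outside `V`, match their edges. -/
lemma Setup.match_edge (S : Setup φ V C D) {a b x y : R₀.X} (he : R₀.Edge (φ.f ⁻¹' V) a b)
    (hx : R₀.Btw a x b) (hxV : φ.f x ∉ V) (hxy : φ.f x = φ.f y) :
    ∃ c d, R₀.Edge (φ.f ⁻¹' V) c d ∧ R₀.Btw c y d ∧ φ.f a = φ.f c ∧ φ.f b = φ.f d := by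
  obtain ⟨c, d, he', hiso, hE, hb⟩ := S.cov y
  obtain ⟨iab, eab⟩ := S.edge_iso he
  have bx := (iso_btw φ.f iab (btw_left _ _) hx (btw_right _ _)).2 hx
  have by' := (iso_btw φ.f hiso (btw_left _ _) hb (btw_right _ _)).2 hb
  rw [← hxy] at by'
  rcases edge_unique S.simpl.branch eab hE hxV bx by' with ⟨e1, e2⟩ | ⟨e1, e2⟩
  · exact ⟨c, d, he', hb, e1.symm, e2.symm⟩
  · exact ⟨d, c, he'.symm, btw_symm hb, e2.symm, e1.symm⟩

lemma Sk.dir_step (S : Setup φ V C D) (ht : 0 ≤ t) (htC : t ≤ C) (K : Sk φ t M p q)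
    {a b x y e : R₀.X} (he : R₀.Edge (φ.f ⁻¹' V) a b) (hx : R₀.Btw a x b)
    (hxW : φ.f x ∉ WT V D t) (hxy : p x = p y) (hye : IsoOn φ.f y e) (hne : p e ≠ p x) :
    ¬ M.Btw (p e) (p x) (p a) ∨ ¬ M.Btw (p e) (p x) (p b) := by
  have hxV : φ.f x ∉ V := fun h => hxW (sub_WT h)
  have hs := (K.sim x y).1 hxy
  obtain ⟨c, d, hcd, hy, hac, hbd⟩ := S.match_edge he hx hxV hs.1
  obtain ⟨iab, eab⟩ := S.edge_iso he
  obtain ⟨icd, ecd⟩ := S.edge_iso hcd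
  have bx := (iso_btw φ.f iab (btw_left _ _) hx (btw_right _ _)).2 hx
  have hlen : dist a b = dist c d := by
    rw [← iab a b (btw_left _ _) (btw_right _ _), ← icd c d (btw_left _ _) (btw_right _ _), hac, hbd]
  have hpos : dist a x = dist c y := by
    rw [← iab a x (btw_left _ _) hx, ← icd c y (btw_left _ _) hy, hac, hs.1]
  have hDfin := S.Dfin.to_subtype
  have hlab : ∀ i : Lbl D, dist a x ≠ al i (dist a b) t := by
    intro i hi
    refine hxW ⟨_, _, eab, bx, i, ?_⟩
    rw [iab a x (btw_left _ _) hx, iab a b (btw_left _ _) (btw_right _ _), hi]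
  obtain ⟨ε, hε, hεl⟩ : ∃ ε > 0, ∀ i : Lbl D, ε < |dist a x - al i (dist a b) t| := by
    obtain ⟨i0, hi0⟩ := Finite.exists_min (fun i : Lbl D => |dist a x - al i (dist a b) t|)
    have := abs_pos.2 (sub_ne_zero.2 (hlab i0))
    exact ⟨_, half_pos this, fun i => lt_of_lt_of_le (half_lt_self this) (hi0 i)⟩
  have hyene : y ≠ e := fun h => hne (by rw [← h, hxy])
  have hye0 := dist_pos.2 hyene
  obtain ⟨y', hy', hd'⟩ := exists_point (R := R₀) y e (min ε (dist y e)) (le_min hε.le hye0.le) (min_le_right _ _)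
  have hyy : dist y y' ≤ ε := hd' ▸ min_le_left _ _
  have hyy0 : 0 < dist y y' := hd' ▸ lt_min hε hye0
  have hxb := hx
  have hyd := hy
  unfold Btw at hxb hyd
  have l0 := hεl (true, none)
  have l1 := hεl (false, none)
  simp only [al, sv, sub_zero] at l0 l1
  have ax0 := dist_nonneg (x := a) (y := x)
  have xb0 := dist_nonneg (x := x) (y := b)
  rw [abs_of_nonneg ax0] at l0
  rw [abs_sub_comm, abs_of_nonneg (by linarith)] at l1
  have hcy' : R₀.Btw c y' d := by
    rcases edge_prop S.br hcd hy y' with k | k | k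
    · exact k
    · exfalso
      unfold Btw at k
      have := dist_nonneg (x := y') (y := c)
      rw [dist_comm y' y] at k
      linarith
    · exfalso
      unfold Btw at k
      have := dist_nonneg (x := y') (y := d)
      rw [dist_comm y' y, dist_comm d y] at k
      linarith
  have hcy'd := hcy'
  unfold Btw at hcy'd
  obtain ⟨x', hx', hx'd⟩ := exists_point (R := R₀) a b (dist c y') dist_nonneg (by
    rw [hlen]; have := dist_nonneg (x := y') (y := d); linarith)
  have hx'b := hx'
  unfold Btw at hx'b
  have habs : |dist c y' - dist c y| ≤ ε := by
    rw [abs_le]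
    have := dist_triangle c y y'
    have := dist_triangle c y' y
    rw [dist_comm y' y] at this
    constructor <;> linarith
  rw [abs_le] at habs
  have hx'0 : 0 < dist a x' := by linarith
  have hx'1 : 0 < dist x' b := by linarith
  have hx'V : φ.f x' ∉ V := by
    intro h
    rcases he.2.2 x' h hx' with e | e
    · rw [e, dist_self] at hx'0; exact lt_irrefl _ hx'0
    · rw [e, dist_self] at hx'1; exact lt_irrefl _ hx'1
  have hsim : Sim φ t x' y' := by
    refine S.sim_edge ht htC he hcd hac hbd hx hx' hy hcy' hx'd hxV hx'V ?_ ?_ hs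
    · intro δ hδ hle
      have := hεl (true, some ⟨δ, hδ⟩)
      simp only [al, sv] at this
      rw [abs_of_nonpos (by linarith)] at this
      linarith
    · intro δ hδ hle
      have := hεl (false, some ⟨δ, hδ⟩)
      simp only [al, sv] at this
      rw [abs_of_nonneg (by linarith)] at this
      linarith
  have hpp := (K.sim x' y').2 hsim
  have pye := K.piso hye
  have b1 : M.Btw (p x) (p x') (p e) := by
    rw [hxy, hpp]
    exact (iso_btw p pye (btw_left _ _) hy' (btw_right _ _)).2 hy'
  have hne' : p x ≠ p x' := by
    rw [hxy, hpp, ← dist_pos, pye y y' (btw_left _ _) hy']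
    exact hyy0
  have hd1 : ¬ M.Btw (p e) (p x) (p x') := fun h => hne' (btw_antisymm h (btw_symm b1))
  have pab := K.piso iab
  rcases btw_total hx hx' with k | k
  · -- x' on the side of b
    right
    have k' := (iso_btw p pab hx hx' (btw_right _ _)).2 k.2
    refine dir_trans hd1 ?_
    intro h
    exact hne' (btw_antisymm (btw_symm h) (btw_symm k'))
  · left
    have k' := (iso_btw p pab (btw_left _ _) hx' hx).2 k.1
    refine dir_trans hd1 ?_
    intro h
    exact hne' (btw_antisymm (btw_symm h) k')

lemma Sk.branch (S : Setup φ V C D) (ht : 0 ≤ t) (htC : t ≤ C) (K : Sk φ t M p q)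
    (m x y z : M.X) (hxy : M.Btw x m y)
    (hyz : M.Btw y m z) (hxz : M.Btw x m z) (hmx : m ≠ x) (hmy : m ≠ y) (hmz : m ≠ z) :
    m ∈ q ⁻¹' (WT V D t) := by
  by_contra hm
  obtain ⟨m, rfl⟩ := K.surj m
  have hm' : φ.f m ∉ WT V D t := by rw [← K.qp]; exact hm
  obtain ⟨a, b, he, hiso, he', hb⟩ := S.cov m
  have hma : p a ≠ p m := by
    intro h
    apply hm'
    rw [← K.qp, ← h, K.qp]; exact sub_WT he.1
  have key' : ∀ y : R₀.X, p y = p m ∨ (¬ M.Btw (p y) (p m) (p a) ∨ ¬ M.Btw (p y) (p m) (p b)) := by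
    intro y
    induction chain' φ a y with
    | refl => exact Or.inr (Or.inl fun h => hma (btw_self h).symm)
    | tail h1 h2 ih =>
      rename_i c e
      by_cases hem : p e = p m
      · exact Or.inl hem
      · right
        by_cases hbt : M.Btw (p c) (p m) (p e)
        · obtain ⟨y, hy, hy'⟩ := iso_lift p (K.piso h2) hbt
          exact K.dir_step S ht htC he hb hm' hy'.symm (h2.mono hy (btw_right _ _)) hem
        · rcases ih with ih | ih | ih
          · exfalso; apply hbt; rw [ih]; exact btw_left _ _
          · exact Or.inl (dir_trans (dir_symm hbt) ih)
          · exact Or.inr (dir_trans (dir_symm hbt) ih)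
  have key : ∀ x, p m ≠ x → ¬ M.Btw x (p m) (p a) ∨ ¬ M.Btw x (p m) (p b) := by
    intro x hx
    obtain ⟨x, rfl⟩ := K.surj x
    exact (key' x).resolve_left hx.symm
  have P : ∀ x y, M.Btw x (p m) y → ∀ u, ¬ M.Btw x (p m) u → ¬ M.Btw y (p m) u → False :=
    fun x y h u h1 h2 => dir_trans h1 (dir_symm h2) h
  rcases key x hmx with h1 | h1 <;> rcases key y hmy with h2 | h2 <;>
    rcases key z hmz with h3 | h3 <;>
  first
  | exact P _ _ hxy _ h1 h2
  | exact P _ _ hyz _ h2 h3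
  | exact P _ _ hxz _ h1 h3

lemma Sk.simpl (S : Setup φ V C D) (ht : 0 ≤ t) (htC : t ≤ C) (K : Sk φ t M p q) :
    Simpl M (q ⁻¹' (WT V D t)) where
  inv := by
    intro g x hx
    show q _ ∈ WT V D t
    rw [K.qact]
    exact WT_inv S.simpl g _ hx
  fin := K.fin S
  branch := K.branch S ht htC
  cover := K.cover S

/-- every edge of the intermediate tree comes from a piece of an edge. -/
lemma Sk.edge_lift (S : Setup φ V C D) (ht : 0 ≤ t) (htC : t ≤ C) (K : Sk φ t M p q) {u v : M.X}
    (he : M.Edge (q ⁻¹' (WT V D t)) u v) (huv : u ≠ v) :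
    ∃ a b x y, R₀.Edge (φ.f ⁻¹' V) a b ∧ R₀.Btw a x b ∧ R₀.Btw a y b ∧ p x = u ∧ p y = v := by
  have hW := K.simpl S ht htC
  obtain ⟨m, hm, _, hmW⟩ := edge_mid he huv
  obtain ⟨m, rfl⟩ := K.surj m
  obtain ⟨a, b, hab, hiso, hE, hb⟩ := S.cov m
  have ma : p a ∈ q ⁻¹' (WT V D t) := by show q _ ∈ WT V D t; rw [K.qp]; exact sub_WT hab.1
  have mb : p b ∈ q ⁻¹' (WT V D t) := by show q _ ∈ WT V D t; rw [K.qp]; exact sub_WT hab.2.1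
  obtain ⟨x, y, h1, h2, h3, h4, h5⟩ := lift_edge hW.fin (K.piso hiso) ma mb hb
  have hb' := (iso_btw p (K.piso hiso) h1 hb h2).2 h3
  rcases edge_unique hW.branch he h5 hmW hm hb' with ⟨e1, e2⟩ | ⟨e1, e2⟩
  · exact ⟨a, b, x, y, hab, h1, h2, e1, e2⟩
  · exact ⟨a, b, y, x, hab, h2, h1, e2, e1⟩

lemma fixed_of_btw {g : G} {P Q x : R.X} (hP : R.act g P = P) (hQ : R.act g Q = Q)
    (hx : R.Btw P x Q) : R.act g x = x := by
  have h := btw_act g hx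
  rw [hP, hQ] at h
  refine btw_unique h hx ?_
  have := dist_act g P x
  rwa [hP] at this

lemma Sk.noinv (S : Setup φ V C D) (ht : 0 ≤ t) (htC : t ≤ C) (K : Sk φ t M p q) (g : G)
    (u v : M.X) (he : M.Edge (q ⁻¹' (WT V D t)) u v) (huv : u ≠ v) (h1 : M.act g u = v)
    (h2 : M.act g v = u) : False := by
  obtain ⟨a, b, x, y, hab, hx, hy, rfl, rfl⟩ := K.edge_lift S ht htC he huv
  obtain ⟨iab, eab⟩ := S.edge_iso hab
  obtain ⟨m, hm, hmd, hmW⟩ := edge_mid he huv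
  have qxy := K.qiso (iab.mono hx hy)
  have hgm : M.act g m = m := by
    have h := btw_act g hm
    rw [h1, h2] at h
    refine btw_unique (btw_symm h) hm ?_
    have e := dist_act g (p y) m
    rw [h2] at e
    have c := dist_comm m (p y)
    unfold Btw at hm
    linarith
  have hqm : R.Btw (φ.f x) (q m) (φ.f y) := by
    rw [← K.qp, ← K.qp]
    exact (iso_btw q qxy (btw_left _ _) hm (btw_right _ _)).2 hm
  have hgw : R.act g (q m) = q m := by rw [← K.qact, hgm]
  have bx := (iso_btw φ.f iab (btw_left _ _) hx (btw_right _ _)).2 hx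
  have by' := (iso_btw φ.f iab (btw_left _ _) hy (btw_right _ _)).2 hy
  have hwAB := btw_convex bx by' hqm
  have hwV : q m ∉ V := fun h => hmW (sub_WT h)
  obtain ⟨U, hUV, hU, hni⟩ := S.noinv
  have hwU : q m ∉ U := fun h => hwV (hUV h)
  obtain ⟨P, Q, hPQ, hw⟩ := hU.exists_edge (q m)
  have hPQne : P ≠ Q := by
    rintro rfl
    exact hwU (btw_self hw ▸ hPQ.1)
  have hgPQ := hPQ.act hU.inv g
  have hgw' := btw_act g hw
  rw [hgw] at hgw'
  rcases edge_unique hU.branch hPQ hgPQ hwU hw hgw' with ⟨e1, e2⟩ | ⟨e1, e2⟩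
  · have side : ∀ A B, R.Edge V A B → R.Btw A (q m) B → R.Btw P A Q := by
      intro A B hAB hb
      have aux : ∀ P, P ∈ U → R.Btw A P (q m) → P = A := by
        intro P hP k
        rcases hAB.2.2 P (hUV hP) (btw_trans_left hb k).1 with e | e
        · exact e
        · exfalso
          rw [e] at k
          exact hwV (btw_antisymm k hb ▸ hAB.2.1)
      rcases edge_prop hU.branch hPQ hw A with k | k | k
      · exact k
      · rw [← aux P hPQ.1 k]; exact btw_left _ _
      · rw [← aux Q hPQ.2.1 k]; exact btw_right _ _
    have hA := side _ _ eab hwAB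
    have hB := side _ _ eab.symm (btw_symm hwAB)
    have hfix := fixed_of_btw e1 e2 (btw_convex hA hB bx)
    have : φ.f y = φ.f x := by
      rw [← K.qp y, ← h1, K.qact, K.qp, hfix]
    rw [← K.qp, ← K.qp] at this
    exact huv (iso_inj qxy (btw_left _ _) (btw_right _ _) this.symm)
  · exact hni g P Q hPQ hPQne e1 e2

end setup

end RGTree

namespace RGTree

variable {G : Type u} [Group G] {R₀ R : RGTree G}

/-- two times with the same combinatorial type. -/
def Same (D : Set ℝ) (t t' : ℝ) : Prop :=
  ∀ l ∈ D, ∀ i j : Lbl D, al i l t ≤ al j l t ↔ al i l t' ≤ al j l t'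

lemma Same.symm {D : Set ℝ} {t t' : ℝ} (h : Same D t t') : Same D t' t :=
  fun l hl i j => (h l hl i j).symm

lemma Same.eq {D : Set ℝ} {t t' : ℝ} (h : Same D t t') {l : ℝ} (hl : l ∈ D) {i j : Lbl D}
    (e : al i l t = al j l t) : al i l t' = al j l t' :=
  le_antisymm ((h l hl i j).1 e.le) ((h l hl j i).1 e.ge)

lemma btw_iff_le {a b x y z : R.X} (hx : R.Btw a x b) (hy : R.Btw a y b) (hz : R.Btw a z b)
    (hxy : dist a x ≤ dist a y) :
    R.Btw x z y ↔ dist a x ≤ dist a z ∧ dist a z ≤ dist a y := by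
  have h1 := dist_of_btw hx hy
  have h2 := dist_of_btw hx hz
  have h3 := dist_of_btw hz hy
  unfold Btw
  rw [h1, h2, h3, abs_of_nonpos (sub_nonpos.2 hxy)]
  constructor
  · intro h
    rcases abs_cases (dist a x - dist a z) with k | k <;>
    rcases abs_cases (dist a z - dist a y) with k' | k' <;>
    constructor <;> linarith
  · rintro ⟨k, k'⟩
    rw [abs_of_nonpos (sub_nonpos.2 k), abs_of_nonpos (sub_nonpos.2 k')]
    ring

/-- Corresponding points. -/
def Corr (φ : RMorphism R₀ R) (V : Set R.X) (D : Set ℝ) (t t' : ℝ) (x x' : R₀.X) : Prop :=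
  ∃ a b, ∃ i : Lbl D, R₀.Edge (φ.f ⁻¹' V) a b ∧ R₀.Btw a x b ∧ R₀.Btw a x' b ∧
    dist a x = al i (dist a b) t ∧ dist a x' = al i (dist a b) t'

section setup

variable {φ : RMorphism R₀ R} {V : Set R.X} {C : ℝ} {D : Set ℝ} {t t' : ℝ}

lemma Corr.symm {x x' : R₀.X} (h : Corr φ V D t t' x x') : Corr φ V D t' t x' x := by
  obtain ⟨a, b, i, h1, h2, h3, h4, h5⟩ := h
  exact ⟨a, b, i, h1, h3, h2, h5, h4⟩

lemma Setup.act_edge (S : Setup φ V C D) {a b : R₀.X} (g : G)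
    (h : R₀.Edge (φ.f ⁻¹' V) a b) : R₀.Edge (φ.f ⁻¹' V) (R₀.act g a) (R₀.act g b) := by
  refine h.act ?_ g
  intro g x hx
  show φ.f (R₀.act g x) ∈ V
  rw [φ.equivariant]
  exact S.simpl.inv g _ hx

lemma Corr.act (S : Setup φ V C D) {x x' : R₀.X} (h : Corr φ V D t t' x x') (g : G) :
    Corr φ V D t t' (R₀.act g x) (R₀.act g x') := by
  obtain ⟨a, b, i, h1, h2, h3, h4, h5⟩ := h
  exact ⟨_, _, i, S.act_edge g h1, btw_act g h2, btw_act g h3, by rw [dist_act, dist_act, h4],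
    by rw [dist_act, dist_act, h5]⟩

lemma Setup.len_mem (S : Setup φ V C D) {a b : R₀.X} (h : R₀.Edge (φ.f ⁻¹' V) a b) :
    dist a b ∈ D := by
  obtain ⟨i, e⟩ := S.edge_iso h
  rw [← i a b (btw_left _ _) (btw_right _ _)]
  exact S.Dedge _ _ e

lemma Corr.fixV (S : Setup φ V C D) (hT : Same D t t') {x x' : R₀.X}
    (h : Corr φ V D t t' x x') (hx : φ.f x ∈ V) : x' = x := by
  obtain ⟨a, b, i, h1, h2, h3, h4, h5⟩ := h
  have hl := S.len_mem h1
  rcases h1.2.2 x hx h2 with e | e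
  · rw [e, dist_self] at h4
    have := hT.eq hl (i := i) (j := (true, none)) (by rw [← h4]; simp [al, sv])
    rw [this] at h5
    simp only [al, sv] at h5
    rw [e]; exact (dist_eq_zero.1 h5).symm
  · rw [e] at h4
    have := hT.eq hl (i := i) (j := (false, none)) (by rw [← h4]; simp [al, sv])
    rw [this] at h5
    simp only [al, sv, sub_zero] at h5
    rw [e]
    exact btw_unique h3 (btw_right _ _) h5

lemma Corr.mem (S : Setup φ V C D) {x x' : R₀.X}
    (h : Corr φ V D t t' x x') : φ.f x ∈ WT V D t := by
  obtain ⟨a, b, i, h1, h2, h3, h4, h5⟩ := h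
  obtain ⟨iab, eab⟩ := S.edge_iso h1
  refine ⟨_, _, eab, (iso_btw φ.f iab (btw_left _ _) h2 (btw_right _ _)).2 h2, i, ?_⟩
  rw [iab a x (btw_left _ _) h2, iab a b (btw_left _ _) (btw_right _ _), h4]

lemma Setup.exists_corr (S : Setup φ V C D) (hT : Same D t t') {a b x : R₀.X}
    (h1 : R₀.Edge (φ.f ⁻¹' V) a b) (h2 : R₀.Btw a x b) (hx : φ.f x ∈ WT V D t) :
    ∃ (i : Lbl D) (x' : R₀.X), R₀.Btw a x' b ∧ dist a x = al i (dist a b) t ∧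
      dist a x' = al i (dist a b) t' := by
  obtain ⟨iab, eab⟩ := S.edge_iso h1
  obtain ⟨i, hi⟩ := lab_of_mem S.simpl hx eab
    ((iso_btw φ.f iab (btw_left _ _) h2 (btw_right _ _)).2 h2)
  rw [iab a x (btw_left _ _) h2, iab a b (btw_left _ _) (btw_right _ _)] at hi
  have hl := S.len_mem h1
  have k1 := (hT _ hl (true, none) i).1 (by rw [← hi]; simp [al, sv])
  have k2 := (hT _ hl i (false, none)).1 (by
    rw [← hi]; simp only [al, sv, sub_zero]
    unfold Btw at h2
    have := dist_nonneg (x := x) (y := b)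
    linarith)
  simp only [al, sv, sub_zero] at k1 k2
  obtain ⟨x', hx', e⟩ := exists_point (R := R₀) a b (al i (dist a b) t') k1 k2
  exact ⟨i, x', hx', hi, e⟩

lemma Setup.func (S : Setup φ V C D) (ht' : 0 ≤ t') (htC : t ≤ C) (hT : Same D t t')
    {x x' y y' : R₀.X} (hx : Corr φ V D t t' x x') (hy : Corr φ V D t t' y y')
    (h : Sim φ t x y) : Sim φ t' x' y' := by
  by_cases hxV : φ.f x ∈ V
  · have hyV : φ.f y ∈ V := h.1 ▸ hxV
    rw [hx.fixV S hT hxV, hy.fixV S hT hyV]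
    refine S.sim_vert ht' htC ?_ hxV h
    intro δ hδ hle
    have := (hT 0 S.Dzero (true, none) (true, some ⟨δ, hδ⟩)).1 (by simp [al, sv, hle])
    simpa [al, sv] using this
  · have hx'V : φ.f x' ∉ V := by
      intro k
      have := hx.symm.fixV S hT.symm k
      rw [this] at hxV
      exact hxV k
    obtain ⟨a, b, i, h1, h2, h3, h4, h5⟩ := hx
    obtain ⟨iab, eab⟩ := S.edge_iso h1
    have core : ∀ c d, ∀ j : Lbl D, R₀.Edge (φ.f ⁻¹' V) c d → R₀.Btw c y d → R₀.Btw c y' d →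
        dist c y = al j (dist c d) t → dist c y' = al j (dist c d) t' → φ.f a = φ.f c →
        φ.f b = φ.f d → Sim φ t' x' y' := by
      intro c d j k1 k2 k3 k4 k5 hac hbd
      obtain ⟨icd, ecd⟩ := S.edge_iso k1
      have hlen : dist a b = dist c d := by
        rw [← iab a b (btw_left _ _) (btw_right _ _), ← icd c d (btw_left _ _) (btw_right _ _),
          hac, hbd]
      have hpos : dist a x = dist c y := by
        rw [← iab a x (btw_left _ _) h2, ← icd c y (btw_left _ _) k2, hac, h.1]
      have hl := S.len_mem h1
      rw [← hlen] at k4 k5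
      have hs : dist a x' = dist c y' := by
        rw [h5, k5]
        apply hT.eq hl
        rw [← h4, ← k4, hpos]
      refine S.sim_edge ht' htC h1 k1 hac hbd h2 h3 k2 k3 hs hxV hx'V ?_ ?_ h
      · intro δ hδ hle
        have := (hT _ hl i (true, some ⟨δ, hδ⟩)).1 (by rw [← h4]; simpa [al, sv] using hle)
        rw [← h5] at this
        simpa [al, sv] using this
      · intro δ hδ hle
        unfold Btw at h2 h3
        have := (hT _ hl (false, some ⟨δ, hδ⟩) i).1 (by
          rw [← h4]; simp only [al, sv]; linarith)
        rw [← h5] at this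
        simp only [al, sv] at this
        linarith
    obtain ⟨c, d, j, k1, k2, k3, k4, k5⟩ := hy
    obtain ⟨icd, ecd⟩ := S.edge_iso k1
    have bx := (iso_btw φ.f iab (btw_left _ _) h2 (btw_right _ _)).2 h2
    have by' := (iso_btw φ.f icd (btw_left _ _) k2 (btw_right _ _)).2 k2
    rw [← h.1] at by'
    rcases edge_unique S.simpl.branch eab ecd hxV bx by' with ⟨e1, e2⟩ | ⟨e1, e2⟩
    · exact core c d j k1 k2 k3 k4 k5 e1.symm e2.symm
    · refine core d c (flip j) k1.symm (btw_symm k2) (btw_symm k3) ?_ ?_ e2.symm e1.symm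
      · have := dist_comm y d
        rw [al_flip, dist_comm d c, ← k4]; unfold Btw at k2; linarith
      · have := dist_comm y' d
        rw [al_flip, dist_comm d c, ← k5]; unfold Btw at k3; linarith

variable {M M' : RGTree G} {p : R₀.X → M.X} {q : M.X → R.X} {p' : R₀.X → M'.X} {q' : M'.X → R.X}

/-- Corresponding vertices. -/
def Rel (φ : RMorphism R₀ R) (V : Set R.X) (D : Set ℝ) (t t' : ℝ) (p : R₀.X → M.X)
    (p' : R₀.X → M'.X) (u : M.X) (u' : M'.X) : Prop :=
  ∃ x x', Corr φ V D t t' x x' ∧ p x = u ∧ p' x' = u'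

lemma Rel.symm {u : M.X} {u' : M'.X} (h : Rel φ V D t t' p p' u u') :
    Rel φ V D t' t p' p u' u := by
  obtain ⟨x, x', h, e, e'⟩ := h
  exact ⟨x', x, h.symm, e', e⟩

lemma Rel.func (S : Setup φ V C D) (ht' : 0 ≤ t') (htC : t ≤ C) (hT : Same D t t')
    (K : Sk φ t M p q) (K' : Sk φ t' M' p' q') {u : M.X} {u' u'' : M'.X}
    (h : Rel φ V D t t' p p' u u') (h2 : Rel φ V D t t' p p' u u'') : u' = u'' := by
  obtain ⟨x, x', h, rfl, rfl⟩ := h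
  obtain ⟨y, y', h', e, rfl⟩ := h2
  exact (K'.sim _ _).2 (S.func ht' htC hT h h' ((K.sim _ _).1 e.symm))

lemma Rel.exists (S : Setup φ V C D) (hT : Same D t t')
    (K : Sk φ t M p q) (K' : Sk φ t' M' p' q') (u : M.X) (hu : u ∈ q ⁻¹' (WT V D t)) :
    ∃ u' ∈ q' ⁻¹' (WT V D t'), Rel φ V D t t' p p' u u' := by
  obtain ⟨x, rfl⟩ := K.surj u
  obtain ⟨a, b, he, _, _, hb⟩ := S.cov x
  have hu' : q (p x) ∈ WT V D t := hu
  rw [K.qp] at hu'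
  obtain ⟨i, x', hx', e, e'⟩ := S.exists_corr hT he hb hu'
  have hc : Corr φ V D t t' x x' := ⟨a, b, i, he, hb, hx', e, e'⟩
  refine ⟨p' x', ?_, x, x', hc, rfl, rfl⟩
  show q' (p' x') ∈ WT V D t'
  rw [K'.qp]
  exact hc.symm.mem S

lemma Rel.edge (S : Setup φ V C D) (ht : 0 ≤ t) (htC : t ≤ C) (ht' : 0 ≤ t') (htC' : t' ≤ C)
    (hT : Same D t t')
    (K : Sk φ t M p q) (K' : Sk φ t' M' p' q') {u v : M.X} {u' v' : M'.X}
    (he : M.Edge (q ⁻¹' (WT V D t)) u v) (huv : u ≠ v)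
    (hu : Rel φ V D t t' p p' u u') (hv : Rel φ V D t t' p p' v v') :
    M'.Edge (q' ⁻¹' (WT V D t')) u' v' ∧ u' ≠ v' := by
  have hne : u' ≠ v' := by
    rintro rfl
    exact huv (Rel.func S ht htC' hT.symm K' K hu.symm hv.symm)
  refine ⟨?_, hne⟩
  obtain ⟨a, b, x, y, hab, hx, hy, rfl, rfl⟩ := K.edge_lift S ht htC he huv
  obtain ⟨iab, eab⟩ := S.edge_iso hab
  have mx : φ.f x ∈ WT V D t := by rw [← K.qp]; exact he.1
  have my : φ.f y ∈ WT V D t := by rw [← K.qp]; exact he.2.1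
  obtain ⟨i, x', hx', ex, ex'⟩ := S.exists_corr hT hab hx mx
  obtain ⟨j, y', hy', ey, ey'⟩ := S.exists_corr hT hab hy my
  have cx : Corr φ V D t t' x x' := ⟨a, b, i, hab, hx, hx', ex, ex'⟩
  have cy : Corr φ V D t t' y y' := ⟨a, b, j, hab, hy, hy', ey, ey'⟩
  obtain rfl := Rel.func S ht' htC hT K K' hu ⟨x, x', cx, rfl, rfl⟩
  obtain rfl := Rel.func S ht' htC hT K K' hv ⟨y, y', cy, rfl, rfl⟩
  refine ⟨?_, ?_, ?_⟩
  · show q' (p' x') ∈ WT V D t'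
    rw [K'.qp]
    exact cx.symm.mem S
  · show q' (p' y') ∈ WT V D t'
    rw [K'.qp]
    exact cy.symm.mem S
  · intro w' hw' hb'
    obtain ⟨z', hz', rfl⟩ := iso_lift p' (K'.piso (iab.mono hx' hy')) hb'
    have hzab' := btw_convex hx' hy' hz'
    have mz : φ.f z' ∈ WT V D t' := by rw [← K'.qp]; exact hw'
    obtain ⟨k, z, hz, ez', ez⟩ := S.exists_corr hT.symm hab hzab' mz
    have cz : Corr φ V D t t' z z' := ⟨a, b, k, hab, hz, hzab', ez, ez'⟩
    have hl := S.len_mem hab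
    have hbz : R₀.Btw x z y := by
      rcases le_total (dist a x) (dist a y) with o | o
      · have o' : dist a x' ≤ dist a y' := by
          rw [ex', ey']; rw [ex, ey] at o; exact (hT _ hl _ _).1 o
        have := (btw_iff_le hx' hy' hzab' o').1 hz'
        rw [ex', ey', ez'] at this
        refine (btw_iff_le hx hy hz o).2 ?_
        rw [ex, ey, ez]
        exact ⟨(hT _ hl _ _).2 this.1, (hT _ hl _ _).2 this.2⟩
      · have o' : dist a y' ≤ dist a x' := by
          rw [ex', ey']; rw [ex, ey] at o; exact (hT _ hl _ _).1 o
        have := (btw_iff_le hy' hx' hzab' o').1 (btw_symm hz')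
        rw [ex', ey', ez'] at this
        refine btw_symm ((btw_iff_le hy hx hz o).2 ?_)
        rw [ex, ey, ez]
        exact ⟨(hT _ hl _ _).2 this.1, (hT _ hl _ _).2 this.2⟩
    have hpz : p z ∈ q ⁻¹' (WT V D t) := by
      show q (p z) ∈ WT V D t
      rw [K.qp]
      exact cz.mem S
    have hpb := (iso_btw p (K.piso iab) hx hz hy).2 hbz
    rcases he.2.2 _ hpz hpb with e | e
    · exact Or.inl (Rel.func S ht' htC hT K K' (u := p z) ⟨z, z', cz, rfl, rfl⟩
        ⟨x, x', cx, e.symm, rfl⟩)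
    · exact Or.inr (Rel.func S ht' htC hT K K' (u := p z) ⟨z, z', cz, rfl, rfl⟩
        ⟨y, y', cy, e.symm, rfl⟩)

lemma Sk.simpIso (S : Setup φ V C D) (ht : 0 ≤ t) (htC : t ≤ C) (ht' : 0 ≤ t') (htC' : t' ≤ C)
    (hT : Same D t t') (K : Sk φ t M p q) (K' : Sk φ t' M' p' q') :
    SimpIso (mkTree (K.simpl S ht htC) (K.noinv S ht htC)).toGTree
      (mkTree (K'.simpl S ht' htC') (K'.noinv S ht' htC')).toGTree := by
  choose F hF hFR using Rel.exists S hT K K'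
  choose F' hF' hFR' using Rel.exists S hT.symm K' K
  refine ⟨⟨fun u => ⟨F u.1 u.2, hF u.1 u.2⟩, fun u => ⟨F' u.1 u.2, hF' u.1 u.2⟩, ?_, ?_⟩, ?_, ?_⟩
  · rintro ⟨u, hu⟩
    exact Subtype.ext (Rel.func S ht htC' hT.symm K' K (hFR' _ (hF u hu)) (hFR u hu).symm)
  · rintro ⟨u, hu⟩
    exact Subtype.ext (Rel.func S ht' htC hT K K' (hFR _ (hF' u hu)) (hFR' u hu).symm)
  · rintro g ⟨u, hu⟩
    refine Subtype.ext ?_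
    refine Rel.func S ht' htC hT K K' (hFR _ _) ?_
    obtain ⟨x, x', hc, e, e'⟩ := hFR u hu
    refine ⟨_, _, hc.act S g, ?_, ?_⟩
    · rw [K.pact, e]; rfl
    · rw [K'.pact, e']; rfl
  · rintro ⟨u, hu⟩ ⟨v, hv⟩
    constructor
    · rintro ⟨h1, h2⟩
      have := Rel.edge S ht htC ht' htC' hT K K' h2 (fun e => h1 (Subtype.ext e)) (hFR u hu) (hFR v hv)
      exact ⟨fun e => this.2 (Subtype.ext_iff.1 e), this.1⟩
    · rintro ⟨h1, h2⟩
      have := Rel.edge S ht' htC' ht htC hT.symm K' K h2 (fun e => h1 (Subtype.ext e))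
        (hFR u hu).symm (hFR v hv).symm
      exact ⟨fun e => this.2 (Subtype.ext_iff.1 e), this.1⟩

end setup

end RGTree

open RGTree in
/-- final assembly -/
lemma final_finite {G : Type u} [Group G] [Group.FG G] (T₀ T : MGTree G)
    (hsame : SameDef T₀.toGTree T.toGTree)
    (R₀ R : RGTree G) (h₀ : RealizationOf R₀ T₀) (h : RealizationOf R T)
    (φ : RMorphism R₀ R) :
    ∃ (n : ℕ) (L : Fin n → GTree G), ∀ t : ℝ, 0 ≤ t →
      ∀ M : RGTree G, IsSkoraIntermediate φ t M →
        ∃ (i : Fin n) (N : MGTree G), RealizationOf M N ∧ SimpIso N.toGTree (L i) := by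
  obtain ⟨V, C, D, S⟩ := exists_setup hsame h₀ h φ
  have hC : 0 ≤ C := by
    obtain ⟨x⟩ := R₀.nontrivial.to_nonempty
    have := S.bound x x rfl
    rwa [dist_self] at this
  have hD := S.Dfin.to_subtype
  let Ty := Set (D × Lbl D × Lbl D)
  have hTy : Finite Ty := inferInstanceAs (Finite (Set (D × Lbl D × Lbl D)))
  let ty : ℝ → Ty := fun t => {x | al x.2.1 x.1.1 t ≤ al x.2.2 x.1.1 t}
  have hsm : ∀ t t', ty t = ty t' → Same D t t' := by
    intro t t' e l hl i j
    have := Set.ext_iff.1 e (⟨l, hl⟩, i, j)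
    exact this
  let P : Ty → Prop := fun τ => ∃ (t : ℝ) (_ : 0 ≤ t) (_ : t ≤ C) (M : RGTree G) (p : R₀.X → M.X)
    (q : M.X → R.X) (_ : Sk φ t M p q), ty t = τ
  choose t ht htC M p q K hty using fun τ : {τ // P τ} => τ.2
  obtain ⟨n, ⟨e⟩⟩ := Finite.exists_equiv_fin {τ // P τ}
  refine ⟨n, fun i => (mkTree ((K (e.symm i)).simpl S (ht _) (htC _))
    ((K (e.symm i)).noinv S (ht _) (htC _))).toGTree, ?_⟩
  intro s hs N hN
  obtain ⟨p₁, q₁, a1, a2, a3, a4, a5, a6, a7⟩ := hN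
  have hK : Sk φ (min s C) N p₁ q₁ := by
    refine ⟨a1, a2, a3, a4, a5, a6, fun x y => ?_⟩
    rw [a7]
    constructor
    · rintro ⟨k1, k2⟩
      refine ⟨k1, fun z hz => le_min (k2 z hz) ?_⟩
      have h1 := morph_lip φ z x
      have h2 := S.bound x y k1
      have h3 := dist_comm z x
      have h4 := dist_nonneg (x := z) (y := y)
      unfold RGTree.Btw at hz
      linarith
    · rintro ⟨k1, k2⟩
      exact ⟨k1, fun z hz => (k2 z hz).trans (min_le_left _ _)⟩
  have hm : 0 ≤ min s C := le_min hs hC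
  let τ : {τ // P τ} := ⟨ty (min s C), min s C, hm, min_le_right _ _, N, p₁, q₁, hK, rfl⟩
  refine ⟨e τ, mkTree (hK.simpl S hm (min_le_right _ _)) (hK.noinv S hm (min_le_right _ _)),
    mkTree_real _ _, ?_⟩
  exact hK.simpIso S hm (min_le_right _ _) (ht _) (htC _)
    (hsm _ _ (by rw [hty, Equiv.symm_apply_apply])) (K (e.symm (e τ)))

/-- **Lemma (Guirardel–Levitt, Lemma 6.5).** Let `f : T₀ → T` be a morphism between two
metric `G`-trees in the same deformation space.  The set of intermediate trees `T_t`
of Skora's deformation of `f` is contained in a finite union of cones: only finitely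
many simplicial trees occur as underlying non-metric trees of the `T_t`. -/
theorem statement_14 {G : Type u} [Group G] [Group.FG G] (T₀ T : MGTree G)
    (hsame : SameDef T₀.toGTree T.toGTree)
    (R₀ R : RGTree G) (h₀ : RealizationOf R₀ T₀) (h : RealizationOf R T)
    (φ : RMorphism R₀ R) :
    ∃ (n : ℕ) (L : Fin n → GTree G), ∀ t : ℝ, 0 ≤ t →
      ∀ M : RGTree G, IsSkoraIntermediate φ t M →
        ∃ (i : Fin n) (N : MGTree G), RealizationOf M N ∧ SimpIso N.toGTree (L i) := by
  exact final_finite T₀ T hsame R₀ R h₀ h φ
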